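/- arXiv:0905.1280 — 7 statements merged into one kernel-verified Lean document; each statement's English description precedes it below -/
import Mathlib

section
/- Let w ∈ W be a θ-twisted involution and let s ∈ S. If ℓ(swθ(s)) = ℓ(w), then swθ(s) = w. -/
namespace CoxeterSystem

theorem reverse_alternatingWord_two_mul {B : Type*} (i j : B) (m : ℕ) :
    (alternatingWord i j (2 * m)).reverse = alternatingWord j i (2 * m) := by
  induction m with
  | zero => rfl
  | succ m ih =>
    rw [show 2 * (m + 1) = 2 * m + 1 + 1 by ring, alternatingWord_succ' j i,
      alternatingWord_succ' j i, alternatingWord_succ, alternatingWord_succ, ← ih]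
    simp [parity_simps]

theorem prod_map_alternatingWord_two_mul {B G : Type*} [Monoid G] (f : B → G) (i j : B) (m : ℕ) :
    ((alternatingWord i j (2 * m)).map f).prod = (f i * f j) ^ m := by
  induction m with
  | zero => simp [alternatingWord]
  | succ m ih =>
    rw [show 2 * (m + 1) = 2 * m + 1 + 1 by ring, alternatingWord_succ, alternatingWord_succ,
      pow_succ, ← ih]
    simp

variable {B W : Type*} [Group W] {M : CoxeterMatrix B} (cs : CoxeterSystem M W)

open scoped Classical in
theorem even_count_leftInvSeq_alternatingWord (i j : B) (t : W) :
    Even ((cs.leftInvSeq (alternatingWord i j (2 * M i j))).count t) := by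
  set L := cs.leftInvSeq (alternatingWord i j (2 * M i j)) with hL
  have hlen : L.length = 2 * M i j := by simp [hL]
  have hdrop : L.drop (M i j) = L.take (M i j) := by
    refine List.ext_getElem (by simp [hlen]; omega) fun k h₁ h₂ => ?_
    have hk : k < M i j := by simp [hlen] at h₂; omega
    rw [List.getElem_drop, List.getElem_take,
      cs.getElem_leftInvSeq_alternatingWord i j _ _ (by omega),
      cs.getElem_leftInvSeq_alternatingWord i j _ _ (by omega),
      prod_alternatingWord_eq_mul_pow, prod_alternatingWord_eq_mul_pow,
      show (2 * (M i j + k) + 1) / 2 = M i j + k by omega, show (2 * k + 1) / 2 = k by omega,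
      pow_add, simple_mul_simple_pow']
    simp [parity_simps]
  rw [← List.take_append_drop (M i j) L, hdrop, List.count_append]
  exact Even.add_self _

open scoped Classical in
/-- The action of a simple reflection on `W × ZMod 2` which conjugates the first component and
flips the second one exactly when the first component is that simple reflection. -/
noncomputable def signedConj (i : B) : Function.End (W × ZMod 2) :=
  fun p => (cs.simple i * p.1 * cs.simple i, p.2 + if p.1 = cs.simple i then 1 else 0)

open scoped Classical in
theorem prod_map_signedConj_apply (ω : List B) (p : W × ZMod 2) :
    (ω.map cs.signedConj).prod p =
      (cs.wordProd ω * p.1 * (cs.wordProd ω)⁻¹, p.2 + ((cs.rightInvSeq ω).count p.1 : ℕ)) := by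
  induction ω with
  | nil => simp [Function.End.one_def]
  | cons i ω ih =>
    rw [List.map_cons, List.prod_cons]
    change cs.signedConj i ((ω.map cs.signedConj).prod p) = _
    rw [ih]
    have h : cs.wordProd ω * p.1 * (cs.wordProd ω)⁻¹ = cs.simple i ↔
        (cs.wordProd ω)⁻¹ * cs.simple i * cs.wordProd ω = p.1 := by
      rw [mul_inv_eq_iff_eq_mul, mul_assoc, inv_mul_eq_iff_eq_mul, eq_comm]
    simp only [signedConj, h, rightInvSeq, List.count_cons, wordProd_cons, mul_inv_rev,
      inv_simple, beq_iff_eq, Prod.mk.injEq]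
    refine ⟨by group, ?_⟩
    push_cast
    ring

theorem isLiftable_signedConj : M.IsLiftable cs.signedConj := by
  classical
  intro i j
  rw [← prod_map_alternatingWord_two_mul]
  funext p
  rw [prod_map_signedConj_apply, ← reverse_alternatingWord_two_mul j i, rightInvSeq_reverse,
    List.count_reverse, M.symmetric i j,
    (ZMod.natCast_eq_zero_iff_even).2 (cs.even_count_leftInvSeq_alternatingWord j i p.1),
    wordProd_reverse, prod_alternatingWord_eq_mul_pow]
  simp [Function.End.one_def]

open scoped Classical in
/-- The parity of the multiplicity of `t` in the right inversion sequence of a word depends only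
on the product of the word. -/
theorem count_rightInvSeq_eq_of_wordProd_eq {ω ω' : List B}
    (h : cs.wordProd ω = cs.wordProd ω') (t : W) :
    ((cs.rightInvSeq ω).count t : ZMod 2) = (cs.rightInvSeq ω').count t := by
  have key (ω : List B) :
      cs.lift ⟨_, cs.isLiftable_signedConj⟩ (cs.wordProd ω) = (ω.map cs.signedConj).prod := by
    rw [wordProd, map_list_prod, List.map_map]
    congr 2
    funext i
    exact cs.lift_apply_simple _ i
  have h₁ := congrFun ((key ω).symm.trans ((congrArg _ h).trans (key ω'))) (t, 0)
  simpa [prod_map_signedConj_apply] using congrArg Prod.snd h₁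

/-- The strong exchange property for a simple right descent. -/
theorem IsRightDescent.simple_mem_rightInvSeq {ω : List B} {j : B}
    (h : cs.IsRightDescent (cs.wordProd ω) j) : cs.simple j ∈ cs.rightInvSeq ω := by
  classical
  obtain ⟨ω', hω', hprod⟩ := cs.exists_isReduced (cs.wordProd ω * cs.simple j)
  have hπ : cs.wordProd (ω'.concat j) = cs.wordProd ω := by
    rw [wordProd_concat, ← hprod, simple_mul_simple_cancel_right]
  have hred : cs.IsReduced (ω'.concat j) := by
    have := cs.isRightDescent_iff.1 h
    rw [hprod, hω'.eq] at this
    rw [IsReduced, hπ, List.length_concat, this]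
  have hmem : cs.simple j ∈ cs.rightInvSeq (ω'.concat j) := by
    rw [rightInvSeq_concat]
    simp
  have hcount := cs.count_rightInvSeq_eq_of_wordProd_eq hπ (cs.simple j)
  rw [List.count_eq_one_of_mem hred.nodup_rightInvSeq hmem] at hcount
  by_contra hnot
  simp [List.count_eq_zero_of_not_mem hnot] at hcount

theorem simple_mul_eq_mul_simple_of_isRightDescent {w : W} {i j : B}
    (hw : ¬cs.IsRightDescent w j) (h : cs.IsRightDescent (cs.simple i * w) j) :
    cs.simple i * w = w * cs.simple j := by
  obtain ⟨ω, hω, rfl⟩ := cs.exists_isReduced w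
  rw [← wordProd_cons] at h
  rcases List.mem_cons.1 (h.simple_mem_rightInvSeq) with h₁ | h₁
  · rw [h₁]
    group
  · exact absurd (cs.isRightInversion_of_mem_rightInvSeq hω h₁).2 hw

/-- If left multiplication by `s i` and right multiplication by `s j` change the length of `w` in
the same direction, and `s i * w * s j` has the same length as `w`, then it equals `w`. -/
theorem simple_mul_mul_simple_eq_self {w : W} {i j : B}
    (h : cs.length (cs.simple i * w) = cs.length (w * cs.simple j))
    (hl : cs.length (cs.simple i * w * cs.simple j) = cs.length w) :
    cs.simple i * w * cs.simple j = w := by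
  rcases cs.length_mul_simple w j with hj | hj
  · rw [cs.simple_mul_eq_mul_simple_of_isRightDescent (i := i) (w := w) (j := j)
      (by unfold IsRightDescent; omega) (by unfold IsRightDescent; omega),
      simple_mul_simple_cancel_right]
  · have := cs.simple_mul_eq_mul_simple_of_isRightDescent (i := i) (w := cs.simple i * w) (j := j)
      (by unfold IsRightDescent; omega)
      (by unfold IsRightDescent; rw [simple_mul_simple_cancel_left]; omega)
    rw [← this, simple_mul_simple_cancel_left]

/-- An automorphism of `W` permuting the simple reflections preserves length. -/
theorem length_map_of_image_range_simple {θ : W ≃* W}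
    (hθ : ⇑θ '' Set.range cs.simple = Set.range cs.simple) (w : W) :
    cs.length (θ w) = cs.length w := by
  have le_of_mapsTo (φ : W ≃* W) (hφ : ∀ i, φ (cs.simple i) ∈ Set.range cs.simple) (u : W) :
      cs.length (φ u) ≤ cs.length u := by
    choose f hf using hφ
    obtain ⟨ω, hω, rfl⟩ := cs.exists_isReduced u
    have : φ (cs.wordProd ω) = cs.wordProd (ω.map f) := by
      simp [wordProd, map_list_prod, Function.comp_def, hf]
    rw [this, hω.eq]
    exact (cs.length_wordProd_le _).trans (by simp)
  refine le_antisymm (le_of_mapsTo θ (fun i => hθ ▸ ⟨_, ⟨i, rfl⟩, rfl⟩) w) ?_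
  have hsymm (i : B) : θ.symm (cs.simple i) ∈ Set.range cs.simple := by
    obtain ⟨_, hx, hi⟩ := hθ.symm ▸ Set.mem_range_self (f := cs.simple) i
    rwa [← hi, θ.symm_apply_apply]
  simpa using le_of_mapsTo θ.symm hsymm (θ w)

end CoxeterSystem

/-- Let `(W,S)` be a Coxeter system with length function `ℓ`, and let `θ` be an automorphism
of `W` with `θ(S) = S` and `θ ∘ θ = id`.  If `w` is a `θ`-twisted involution (`θ(w) = w⁻¹`),
`s ∈ S` and `ℓ(swθ(s)) = ℓ(w)`, then `swθ(s) = w`. -/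
theorem twisted_involution_fixed_of_length_eq
    {B W : Type*} [Group W] {M : CoxeterMatrix B} (cs : CoxeterSystem M W)
    (θ : W ≃* W) (hθS : ⇑θ '' Set.range cs.simple = Set.range cs.simple)
    (hθ2 : ∀ u : W, θ (θ u) = u)
    (w : W) (hw : θ w = w⁻¹)
    (s : W) (hs : s ∈ Set.range cs.simple)
    (hl : cs.length (s * w * θ s) = cs.length w) :
    s * w * θ s = w := by
  obtain ⟨i, rfl⟩ := hs
  obtain ⟨j, hj⟩ : θ (cs.simple i) ∈ Set.range cs.simple := hθS ▸ ⟨_, ⟨i, rfl⟩, rfl⟩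
  rw [← hj] at hl ⊢
  refine cs.simple_mul_mul_simple_eq_self ?_ hl
  rw [← cs.length_map_of_image_range_simple hθS, map_mul, hw, ← hj, ← cs.length_inv]
  simp
end

section
/- Suppose U is uniquely 2-divisible and let φ be a permutation of X satisfying φ ∘ φ = id, φ(∞) = ∞, and φUφ⁻¹ = U. If X contains at least two elements, then there exists b ∈ X with b ≠ ∞ and φ(b) = b; that is, an involutive automorphism of a Moufang set with uniquely 2-divisible root groups which fixes a point necessarily fixes a second point. -/
/-- Let `X` be a set with a distinguished point `∞` and let `U ≤ Sym(X)` be a subgroup all of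
whose elements fix `∞` and which acts sharply transitively on `X ∖ {∞}`.  Suppose `U` is
uniquely 2-divisible and let `φ` be a permutation of `X` with `φ ∘ φ = id`, `φ(∞) = ∞` and
`φUφ⁻¹ = U`.  If `X` has at least two elements, then `φ` fixes a second point `b ≠ ∞`. -/
theorem moufang_set_involution_fixes_second_point
    {X : Type*} [Nontrivial X] (inf : X) (U : Subgroup (Equiv.Perm X))
    (hfix : ∀ g ∈ U, g inf = inf)
    (htrans : ∀ a b : X, a ≠ inf → b ≠ inf → ∃! g : U, (g : Equiv.Perm X) a = b)
    (hdiv : ∀ g : U, ∃! h : U, h * h = g)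
    (φ : Equiv.Perm X) (hφ2 : ∀ x, φ (φ x) = x) (hφinf : φ inf = inf)
    (hφU : (fun g => φ * g * φ⁻¹) '' (U : Set (Equiv.Perm X)) = U) :
    ∃ b : X, b ≠ inf ∧ φ b = b := by
  have φ_inv : φ⁻¹ = φ := by
    ext x
    rw [Equiv.Perm.inv_eq_iff_eq, hφ2]
  have conj_mem (g : U) : φ * g * φ⁻¹ ∈ U := by
    have h_mem : φ * g * φ⁻¹ ∈ (fun g => φ * g * φ⁻¹) '' (U : Set (Equiv.Perm X)) :=
      ⟨g, g.2, rfl⟩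
    rw [hφU] at h_mem
    exact h_mem
  obtain ⟨a, ha⟩ := exists_ne inf
  have hφa : φ a ≠ inf := fun h => ha (φ.injective (h.trans hφinf.symm))
  obtain ⟨g, hg, -⟩ := htrans a (φ a) ha hφa
  obtain ⟨h, rfl, -⟩ := hdiv g
  let c (u : U) : U := ⟨φ * u * φ⁻¹, conj_mem u⟩
  have c_mul (u v : U) : c u * c v = c (u * v) := by
    ext1
    simp [c, mul_assoc]
  have c_sq : c (h * h) = h⁻¹ * h⁻¹ := by
    rw [← mul_inv_rev, eq_inv_iff_mul_eq_one]
    refine (htrans a a ha ha).unique ?_ rfl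
    rw [Subgroup.coe_mul, Equiv.Perm.mul_apply, hg]
    simp only [c, Equiv.Perm.mul_apply, φ_inv, hφ2, hg]
  have c_h : c h = h⁻¹ := (hdiv (c (h * h))).unique (c_mul h h) c_sq.symm
  refine ⟨(h : Equiv.Perm X) a, fun h_inf => ha ?_, ?_⟩
  · exact (h : Equiv.Perm X).injective (h_inf.trans (hfix h h.2).symm)
  · calc
      φ ((h : Equiv.Perm X) a) = (c h : Equiv.Perm X) (φ a) := by
        simp [c]
      _ = (h : Equiv.Perm X) a := by
        rw [c_h, ← hg]
        simp
end

section
/- Let θ be an automorphism of G with θ ∘ θ = id such that θ(B₊) = gB₋g⁻¹ for some g ∈ G. Then there exists x ∈ G such that θ(B₊) = xB₋x⁻¹, θ(B₋) = xB₊x⁻¹, and θ(x)·x ∈ T. -/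
open scoped Pointwise

/-- The double coset `B₁ w B₂` in `G`, where `w` is an element of the quotient `N ⧸ NT`:
the set of all `b₁ n b₂` with `b₁ ∈ B₁`, `b₂ ∈ B₂` and `n ∈ N` a representative of `w`. -/
def DoubleCoset' {G : Type*} [Group G] (B1 : Subgroup G) {N : Subgroup G}
    (NT : Subgroup N) (w : N ⧸ NT) (B2 : Subgroup G) : Set G :=
  {x | ∃ b1 ∈ B1, ∃ n : N, (QuotientGroup.mk n : N ⧸ NT) = w ∧ ∃ b2 ∈ B2, x = b1 * n * b2}

/-- The axioms (BN1), (BN2) of a Tits system `(G, B, N)`, written in terms of the set `S ⊆ N` of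
all representatives of the simple generators. -/
structure IsTitsSystem {G : Type*} [Group G] (B N : Subgroup G) (S : Set N) : Prop where
  sup_eq_top : B ⊔ N = ⊤
  conj_mem : ∀ n t : N, (t : G) ∈ B → ((n * t * n⁻¹ : N) : G) ∈ B
  inv_mem : ∀ s ∈ S, s⁻¹ ∈ S
  induction_right : ∀ P : N → Prop, P 1 → (∀ n t : N, (t : G) ∈ B → P n → P (n * t)) →
    (∀ n, ∀ s ∈ S, P n → P (n * s)) → ∀ n, P n
  mul_mul_simple : ∀ n : N, ∀ s ∈ S, ∀ b ∈ B,
    (∃ c ∈ B, ∃ d ∈ B, (n : G) * b * s = c * (n * s) * d) ∨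
    (∃ c ∈ B, ∃ d ∈ B, (n : G) * b * s = c * n * d)
  exists_conj_notMem : ∀ s ∈ S, ∃ b ∈ B, (s : G)⁻¹ * b * s ∉ B

namespace IsTitsSystem

variable {G : Type*} [Group G] {B N : Subgroup G} {S : Set N}

theorem simple_notMem (h : IsTitsSystem B N S) {s : N} (hs : s ∈ S) : (s : G) ∉ B := by
  intro hB
  obtain ⟨b, hb, hb'⟩ := h.exists_conj_notMem s hs
  exact hb' (B.mul_mem (B.mul_mem (B.inv_mem hB) hb) hB)

theorem conj_simple (h : IsTitsSystem B N S) {s : N} (hs : s ∈ S) {b : G} (hb : b ∈ B) :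
    (s : G)⁻¹ * b * s ∈ B ∨ ∃ c ∈ B, ∃ d ∈ B, (s : G)⁻¹ * b * s = c * (s : G)⁻¹ * d := by
  rcases h.mul_mul_simple s⁻¹ s hs b hb with ⟨c, hc, d, hd, e⟩ | ⟨c, hc, d, hd, e⟩
  · left
    have e' : (s : G)⁻¹ * b * s = c * d := by simpa using e
    rw [e']
    exact B.mul_mem hc hd
  · right
    exact ⟨c, hc, d, hd, by simpa using e⟩

/-- An element of `N` lying in `B s B` represents `s`. -/
theorem inv_mul_mem_of_mem_simple (h : IsTitsSystem B N S) {m s : N} (hs : s ∈ S) {c d : G}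
    (hc : c ∈ B) (hd : d ∈ B) (e : (m : G) = c * s * d) : (s : G)⁻¹ * m ∈ B := by
  have e1 : (m : G) * d⁻¹ * ((s⁻¹ : N) : G) = c := by
    rw [e]; push_cast; group
  rcases h.mul_mul_simple m s⁻¹ (h.inv_mem s hs) d⁻¹ (B.inv_mem hd) with
    ⟨c', hc', d', hd', e'⟩ | ⟨c', hc', d', hd', e'⟩
  · have hm : ((m * s⁻¹ : N) : G) ∈ B := by
      have : ((m * s⁻¹ : N) : G) = c'⁻¹ * c * d'⁻¹ := by
        rw [← e1, e']; push_cast; group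
      rw [this]
      exact B.mul_mem (B.mul_mem (B.inv_mem hc') hc) (B.inv_mem hd')
    have := h.conj_mem s⁻¹ _ hm
    have e2 : ((s⁻¹ * (m * s⁻¹) * s⁻¹⁻¹ : N) : G) = (s : G)⁻¹ * m := by
      push_cast; group
    rwa [e2] at this
  · exfalso
    have hm : (m : G) ∈ B := by
      have : (m : G) = c'⁻¹ * c * d'⁻¹ := by
        rw [← e1, e']; group
      rw [this]
      exact B.mul_mem (B.mul_mem (B.inv_mem hc') hc) (B.inv_mem hd')
    refine h.simple_notMem hs ?_
    have : (s : G) = c⁻¹ * m * d⁻¹ := by rw [e]; group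
    rw [this]
    exact B.mul_mem (B.mul_mem (B.inv_mem hc) hm) (B.inv_mem hd)

/-- If right multiplication by simple elements preserves `B' N B`, then `G = B' N B`. -/
theorem exists_eq_mul_mul (h : IsTitsSystem B N S) (B' : Subgroup G)
    (hstep : ∀ n : N, ∀ s ∈ S, ∀ b ∈ B, ∃ m : N, ∃ c ∈ B', ∃ d ∈ B, (n : G) * b * s = c * m * d)
    (x : G) : ∃ n : N, ∃ c ∈ B', ∃ d ∈ B, x = c * n * d := by
  have hN : ∀ m : N, ∀ x : G, (∃ n : N, ∃ c ∈ B', ∃ d ∈ B, x = c * n * d) →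
      ∃ n : N, ∃ c ∈ B', ∃ d ∈ B, x * m = c * n * d := by
    refine h.induction_right _ (by simp) ?_ ?_
    · intro n t ht ih x hx
      obtain ⟨k, c, hc, d, hd, e⟩ := ih x hx
      refine ⟨k, c, hc, d * t, B.mul_mem hd ht, ?_⟩
      push_cast
      rw [← mul_assoc, e]
      group
    · intro n s hs ih x hx
      obtain ⟨k, c, hc, d, hd, e⟩ := ih x hx
      obtain ⟨m, c', hc', d', hd', e'⟩ := hstep k s hs d hd
      refine ⟨m, c * c', B'.mul_mem hc hc', d', hd', ?_⟩
      push_cast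
      rw [← mul_assoc, e]
      calc c * k * d * s = c * (k * d * s) := by group
        _ = _ := by rw [e']; group
  have hx : x ∈ Subgroup.closure ((B : Set G) ∪ N) := by
    rw [← Subgroup.sup_eq_closure, h.sup_eq_top]; trivial
  have hmul : ∀ y ∈ (B : Set G) ∪ N, ∀ x : G, (∃ n : N, ∃ c ∈ B', ∃ d ∈ B, x = c * n * d) →
      ∃ n : N, ∃ c ∈ B', ∃ d ∈ B, x * y = c * n * d := by
    rintro y (hy | hy) x hx
    · obtain ⟨k, c, hc, d, hd, e⟩ := hx
      exact ⟨k, c, hc, d * y, B.mul_mem hd hy, by rw [e]; group⟩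
    · exact hN ⟨y, hy⟩ x hx
  induction hx using Subgroup.closure_induction_right with
  | one => exact ⟨1, 1, B'.one_mem, 1, B.one_mem, by simp⟩
  | mul_right x _ y hy ih => exact hmul y hy x ih
  | mul_inv_cancel x _ y hy ih =>
    refine hmul y⁻¹ ?_ x ih
    rcases hy with hy | hy
    · exact Or.inl (B.inv_mem hy)
    · exact Or.inr (N.inv_mem hy)

theorem bruhat (h : IsTitsSystem B N S) (x : G) :
    ∃ n : N, ∃ c ∈ B, ∃ d ∈ B, x = c * n * d := by
  refine h.exists_eq_mul_mul B (fun n s hs b hb => ?_) x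
  rcases h.mul_mul_simple n s hs b hb with ⟨c, hc, d, hd, e⟩ | ⟨c, hc, d, hd, e⟩
  · exact ⟨n * s, c, hc, d, hd, by simpa using e⟩
  · exact ⟨n, c, hc, d, hd, e⟩

end IsTitsSystem

/-- The axioms of a saturated twin BN-pair in which the chambers fixed by `T = B₊ ∩ N` lie in the
standard twin apartment, written in terms of the set `S ⊆ N` of all representatives of the simple
generators and of the length function `ℓ` on `N`. -/
structure IsSaturatedTwin {G : Type*} [Group G] (Bp Bm N : Subgroup G) (S : Set N)
    (ℓ : N → ℕ) : Prop where
  pos : IsTitsSystem Bp N S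
  neg : IsTitsSystem Bm N S
  mem_iff : ∀ n : N, (n : G) ∈ Bp ↔ (n : G) ∈ Bm
  mem_of_mem_of_mem : ∀ x ∈ Bp, x ∈ Bm → x ∈ N
  length_lt_or_gt : ∀ n, ∀ s ∈ S, ℓ (n * s) < ℓ n ∨ ℓ n < ℓ (n * s)
  exists_descent : ∀ n : N, (n : G) ∉ Bp → ∃ s ∈ S, ℓ (n * s) < ℓ n
  mul_mul_descent : ∀ n, ∀ s ∈ S, ℓ (n * s) < ℓ n → ∀ b ∈ Bm,
    ∃ c ∈ Bp, ∃ d ∈ Bm, (n : G) * b * s = c * (n * s) * d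
  mul_simple_notMem : ∀ s ∈ S, ∀ b ∈ Bp, b * (s : G) ∉ Bm
  fixed_pos : ∀ g : G, (∀ t : N, (t : G) ∈ Bp → g⁻¹ * t * g ∈ Bp) → ∃ n : N, (n : G)⁻¹ * g ∈ Bp
  fixed_neg : ∀ g : G, (∀ t : N, (t : G) ∈ Bp → g⁻¹ * t * g ∈ Bm) → ∃ n : N, (n : G)⁻¹ * g ∈ Bm

namespace IsSaturatedTwin

variable {G : Type*} [Group G] {Bp Bm N : Subgroup G} {S : Set N} {ℓ : N → ℕ}

theorem birkhoff (h : IsSaturatedTwin Bp Bm N S ℓ) (x : G) :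
    ∃ n : N, ∃ c ∈ Bp, ∃ d ∈ Bm, x = c * n * d := by
  refine h.neg.exists_eq_mul_mul Bp (fun n s hs b hb => ?_) x
  rcases h.length_lt_or_gt n s hs with hl | hl
  · obtain ⟨c, hc, d, hd, e⟩ := h.mul_mul_descent n s hs hl b hb
    exact ⟨n * s, c, hc, d, hd, by simpa using e⟩
  · rcases h.neg.conj_simple hs hb with hB | ⟨c, hc, d, hd, e⟩
    · refine ⟨n * s, 1, Bp.one_mem, _, hB, ?_⟩
      push_cast; group
    · obtain ⟨c', hc', d', hd', e'⟩ :=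
        h.mul_mul_descent (n * s) s⁻¹ (h.neg.inv_mem s hs) (by simpa using hl) c hc
      refine ⟨n, c', hc', d' * d, Bm.mul_mem hd' hd, ?_⟩
      push_cast at e'
      calc (n : G) * b * s = n * s * ((s : G)⁻¹ * b * s) := by group
        _ = (n * s * c * (s : G)⁻¹) * d := by rw [e]; group
        _ = _ := by rw [e']; group

/-- If the stabiliser of `B₊` and `n B₋` is contained in `T`, then a descent `s` of `n` satisfies
`B₊ n B₋ = B₊ n s B₋`. -/
theorem eq_mul_descent (h : IsSaturatedTwin Bp Bm N S ℓ) {n s : N} (hs : s ∈ S)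
    (hl : ℓ (n * s) < ℓ n) (hstab : ∀ y ∈ Bp, (n : G)⁻¹ * y * n ∈ Bm → y ∈ N) :
    ∃ c ∈ Bp, ∃ d ∈ Bm, (n : G) = c * (n * s) * d := by
  obtain ⟨b, hb, hbs⟩ := h.neg.exists_conj_notMem s hs
  obtain ⟨c, hc, d, hd, e⟩ := h.mul_mul_descent n s hs hl b hb
  have ec : c * n = n * b * (s * d⁻¹ * (s : G)⁻¹) := by
    calc c * n = c * (n * s) * d * (d⁻¹ * (s : G)⁻¹) := by group
      _ = _ := by rw [← e]; group
  have hconj := h.neg.conj_simple (h.neg.inv_mem s hs) (Bm.inv_mem hd)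
  simp only [InvMemClass.coe_inv, inv_inv] at hconj
  rcases hconj with hB | ⟨c', hc', d', hd', e'⟩
  · exfalso
    have hcm : (n : G)⁻¹ * c * n ∈ Bm := by
      have : (n : G)⁻¹ * c * n = b * (s * d⁻¹ * (s : G)⁻¹) := by
        rw [mul_assoc, ec]; group
      rw [this]; exact Bm.mul_mem hb hB
    have hcN := hstab c hc hcm
    have ht := h.pos.conj_mem (n * s)⁻¹ ⟨c, hcN⟩ hc
    rw [h.mem_iff] at ht
    refine hbs ?_
    have : (s : G)⁻¹ * b * s = (((n * s)⁻¹ * ⟨c, hcN⟩ * (n * s)⁻¹⁻¹ : N) : G) * d := by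
      have : (s : G)⁻¹ * b * s = (s : G)⁻¹ * (n : G)⁻¹ * (n * b * s) := by group
      rw [this, e]; push_cast; group
    rw [this]; exact Bm.mul_mem ht hd
  · obtain ⟨c'', hc'', d'', hd'', e''⟩ := h.mul_mul_descent n s hs hl (b * c') (Bm.mul_mem hb hc')
    refine ⟨c⁻¹ * c'', Bp.mul_mem (Bp.inv_mem hc) hc'', d'' * d', Bm.mul_mem hd'' hd', ?_⟩
    calc (n : G) = c⁻¹ * (c * n) := by group
      _ = c⁻¹ * (n * (b * c') * s) * d' := by rw [ec, e']; group
      _ = _ := by rw [e'']; group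

/-- An element of `B₊` normalising `B₋` lies in `T`. -/
theorem mem_of_normalizes (h : IsSaturatedTwin Bp Bm N S ℓ) {y : G} (hy : y ∈ Bp)
    (hn : ∀ z, y * z * y⁻¹ ∈ Bm ↔ z ∈ Bm) : y ∈ N := by
  obtain ⟨m, hm⟩ := h.fixed_neg y (fun t ht => by
    rw [← hn]
    have : y * (y⁻¹ * t * y) * y⁻¹ = t := by group
    rw [this]; exact (h.mem_iff t).1 ht)
  by_cases hmp : (m : G) ∈ Bp
  · refine h.mem_of_mem_of_mem y hy ?_
    have := Bm.mul_mem ((h.mem_iff m).1 hmp) hm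
    rwa [mul_inv_cancel_left] at this
  exfalso
  obtain ⟨s, hs, hl⟩ := h.exists_descent m hmp
  obtain ⟨c, hc, d, hd, e⟩ := h.eq_mul_descent hs hl (fun z hz hz' => by
    refine h.mem_of_mem_of_mem z hz ?_
    have h1 := Bm.mul_mem (Bm.mul_mem (Bm.inv_mem hm) hz') hm
    rw [← hn] at h1
    convert h1 using 1
    group)
  obtain ⟨c', hc', d', hd', e'⟩ := h.mul_mul_descent m s hs hl _ hm
  have key : (y⁻¹ * c' * c⁻¹ * y)⁻¹ * (s : G) = ((m : G)⁻¹ * y)⁻¹ * d⁻¹ * d' := by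
    have e1 : y * s = c' * (m * s) * d' := by rw [← e']; group
    have e2 : (m : G) * s = c⁻¹ * m * d⁻¹ := by nth_rw 2 [e]; group
    have e3 : (s : G) = y⁻¹ * (c' * (c⁻¹ * m * d⁻¹) * d') := by rw [← e2, ← e1]; group
    rw [e3]; group
  refine h.mul_simple_notMem s hs _ (Bp.inv_mem (Bp.mul_mem (Bp.mul_mem (Bp.mul_mem
    (Bp.inv_mem hy) hc') (Bp.inv_mem hc)) hy)) ?_
  rw [key]
  exact Bm.mul_mem (Bm.mul_mem (Bm.inv_mem hm) (Bm.inv_mem hd)) hd'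

/-- If an automorphism maps the pair `(B₋, B₊)` to `(B₊, n B₋ n⁻¹)`, then
`B₊ ∩ n B₋ n⁻¹` is contained in `N`. -/
theorem mem_of_mem_inter_conj (h : IsSaturatedTwin Bp Bm N S ℓ) {n : N} (ψ : G ≃* G)
    (hm : ∀ x, ψ x ∈ Bp ↔ x ∈ Bm) (hp : ∀ x, (n : G)⁻¹ * ψ x * n ∈ Bm ↔ x ∈ Bp)
    {y : G} (hy : y ∈ Bp) (hy' : (n : G)⁻¹ * y * n ∈ Bm) : y ∈ N := by
  have conj_mem : ∀ m t : N, (t : G) ∈ Bp → (m : G)⁻¹ * t * m ∈ Bp := fun m t ht => by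
    simpa using h.pos.conj_mem m⁻¹ t ht
  have conj_mem' : ∀ m t : N, (t : G) ∈ Bp → (m : G)⁻¹ * t * m ∈ Bm := fun m t ht => by
    simpa using h.neg.conj_mem m⁻¹ t ((h.mem_iff t).1 ht)
  have chamber : ∀ m : N, ∃ m' : N, (m' : G)⁻¹ * ψ m ∈ Bp := by
    intro m
    refine h.fixed_pos _ (fun t ht => ?_)
    obtain ⟨u, hu⟩ := ψ.surjective t
    have hum : u ∈ Bm := by rw [← hm, hu]; exact ht
    have hup : u ∈ Bp := by rw [← hp, hu]; exact conj_mem' n t ht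
    have huN := h.mem_of_mem_of_mem u hup hum
    have := (hm _).2 (conj_mem' m ⟨u, huN⟩ hup)
    simpa [hu] using this
  have panel : ∀ s ∈ S, ∃ k : N, ∃ c ∈ Bp, ∃ d ∈ Bp, ψ k = c * s * d := by
    intro s _
    obtain ⟨k, c, hc, d, hd, e⟩ := h.neg.bruhat (ψ.symm s)
    refine ⟨k, (ψ c)⁻¹, Bp.inv_mem ((hm c).2 hc), (ψ d)⁻¹, Bp.inv_mem ((hm d).2 hd), ?_⟩
    have : (s : G) = ψ c * ψ k * ψ d := by rw [← map_mul, ← map_mul, ← e]; simp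
    rw [this]; group
  have surj : ∀ m' : N, ∃ m : N, (m' : G)⁻¹ * ψ m ∈ Bp := by
    refine h.pos.induction_right _ ⟨1, by simp⟩ ?_ ?_
    · rintro m' (t : N) ht ⟨m, hmm⟩
      refine ⟨m, ?_⟩
      have : ((m' * t : N) : G)⁻¹ * ψ m = (t : G)⁻¹ * ((m' : G)⁻¹ * ψ m) := by push_cast; group
      rw [this]; exact Bp.mul_mem (Bp.inv_mem ht) hmm
    · rintro m' s hs ⟨m, hmm⟩
      obtain ⟨k, c, hc, d, hd, e⟩ := panel s hs
      obtain ⟨q, hq⟩ := chamber (m * k)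
      refine ⟨m * k, ?_⟩
      have e1 : ((m'⁻¹ * q : N) : G) =
          ((m' : G)⁻¹ * ψ m * c) * s * (d * ((q : G)⁻¹ * ψ (m * k : N))⁻¹) := by
        push_cast
        rw [map_mul, e]; group
      have h1 := h.pos.inv_mul_mem_of_mem_simple hs (Bp.mul_mem hmm hc)
        (Bp.mul_mem hd (Bp.inv_mem hq)) e1
      have := Bp.mul_mem h1 hq
      convert this using 1
      push_cast; group
  obtain ⟨t, rfl⟩ := ψ.surjective y
  rw [hm] at hy
  rw [hp] at hy'
  obtain ⟨m, hmn⟩ := surj n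
  have h1 := (hm _).2 (conj_mem' m ⟨t, h.mem_of_mem_of_mem t hy' hy⟩ hy')
  have h2 : (n : G)⁻¹ * ψ t * n ∈ Bp := by
    have := Bp.mul_mem (Bp.mul_mem hmn h1) (Bp.inv_mem hmn)
    convert this using 1
    simp only [map_mul, map_inv]; group
  have h3 := h.mem_of_mem_of_mem _ h2 ((hp t).2 hy')
  have := N.mul_mem (N.mul_mem n.2 h3) (N.inv_mem n.2)
  convert this using 1
  group

theorem exists_flip (h : IsSaturatedTwin Bp Bm N S ℓ) (θ : G ≃* G) (hθ : ∀ x, θ (θ x) = x)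
    {g : G} (hg : ∀ x, g⁻¹ * θ x * g ∈ Bm ↔ x ∈ Bp) :
    ∃ x : G, (∀ y, x⁻¹ * θ y * x ∈ Bm ↔ y ∈ Bp) ∧ (∀ y, x⁻¹ * θ y * x ∈ Bp ↔ y ∈ Bm) ∧
      θ x * x ∈ Bp ⊓ N := by
  have swap : ∀ g : G, (∀ x, g⁻¹ * θ x * g ∈ Bm ↔ x ∈ Bp) →
      ∀ x, θ g * θ x * (θ g)⁻¹ ∈ Bp ↔ x ∈ Bm := by
    intro g hg x
    rw [← hg]
    simp only [map_mul, map_inv, hθ]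
    rw [show g⁻¹ * (g * x * g⁻¹) * g = x by group]
  obtain ⟨n, hn, hmin⟩ : ∃ n : N, (∃ c ∈ Bp, ∃ d ∈ Bm, θ g * g = c * n * d) ∧
      ∀ m : N, (∃ c ∈ Bp, ∃ d ∈ Bm, θ g * g = c * m * d) → ℓ n ≤ ℓ m := by
    obtain ⟨n₀, hn₀⟩ := h.birkhoff (θ g * g)
    obtain ⟨n, hn, hmin⟩ := (measure ℓ).wf.has_min
      {n : N | ∃ c ∈ Bp, ∃ d ∈ Bm, θ g * g = c * n * d} ⟨n₀, hn₀⟩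
    exact ⟨n, hn, fun m hm => not_lt.1 (hmin m hm)⟩
  obtain ⟨c, hc, d, hd, e⟩ := hn
  obtain ⟨x, hx, p, hp, e'⟩ : ∃ x, (∀ y, x⁻¹ * θ y * x ∈ Bm ↔ y ∈ Bp) ∧
      ∃ p ∈ Bp, θ x * x = p * n := by
    refine ⟨g * d⁻¹, fun y => ?_, θ g * θ d⁻¹ * (θ g)⁻¹ * c,
      Bp.mul_mem ((swap g hg _).2 (Bm.inv_mem hd)) hc, ?_⟩
    · rw [← hg y]
      have : (g * d⁻¹)⁻¹ * θ y * (g * d⁻¹) = d * (g⁻¹ * θ y * g) * d⁻¹ := by group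
      rw [this, Bm.mul_mem_cancel_right (Bm.inv_mem hd), Bm.mul_mem_cancel_left hd]
    · have : θ (g * d⁻¹) * (g * d⁻¹) = θ g * θ d⁻¹ * (θ g)⁻¹ * (θ g * g) * d⁻¹ := by
        rw [map_mul]; group
      rw [this, e]; group
  have ex : θ x = p * n * x⁻¹ := by rw [← e']; group
  have hx' := swap x hx
  have hpos : ∀ y, (n * x⁻¹) * θ y * (n * x⁻¹)⁻¹ ∈ Bp ↔ y ∈ Bm := by
    intro y
    rw [← hx', ex]
    have : p * n * x⁻¹ * θ y * (p * n * x⁻¹)⁻¹ =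
        p * ((n * x⁻¹) * θ y * (n * x⁻¹)⁻¹) * p⁻¹ := by group
    rw [this, Bp.mul_mem_cancel_right (Bp.inv_mem hp), Bp.mul_mem_cancel_left hp]
  have hnB : (n : G) ∈ Bp := by
    by_contra hnB
    obtain ⟨s, hs, hl⟩ := h.exists_descent n hnB
    obtain ⟨c', hc', d', hd', e''⟩ := h.eq_mul_descent hs hl (fun y hy hy' =>
      h.mem_of_mem_inter_conj (θ.trans (MulAut.conj ((n : G) * x⁻¹)))
        (fun z => hpos z)
        (fun z => by
          rw [← hx z]
          have : (n : G)⁻¹ * (θ.trans (MulAut.conj ((n : G) * x⁻¹))) z * n =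
              x⁻¹ * θ z * x := by
            simp only [MulEquiv.trans_apply, MulAut.conj_apply]; group
          rw [this])
        hy hy')
    refine absurd (hmin (n * s) ⟨c * c', Bp.mul_mem hc hc', d' * d, Bm.mul_mem hd' hd, ?_⟩)
      (not_le.2 hl)
    rw [e, e'']
    push_cast
    group
  have hθx : θ x * x ∈ Bp := by rw [e']; exact Bp.mul_mem hp hnB
  have hxm : ∀ y, x⁻¹ * θ y * x ∈ Bp ↔ y ∈ Bm := by
    intro y
    rw [← hpos y]
    have : (n * x⁻¹) * θ y * (n * x⁻¹)⁻¹ = n * (x⁻¹ * θ y * x) * (n : G)⁻¹ := by group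
    rw [this, Bp.mul_mem_cancel_right (Bp.inv_mem hnB), Bp.mul_mem_cancel_left hnB]
  refine ⟨x, hx, hxm, hθx, h.mem_of_normalizes hθx (fun z => ?_)⟩
  rw [← hxm, ← hx' z]
  simp only [map_mul, map_inv, hθ]
  rw [show x⁻¹ * (x * θ x * θ z * (x * θ x)⁻¹) * x = θ x * θ z * (θ x)⁻¹ by group]

end IsSaturatedTwin

theorem mem_doubleCoset'_mk {G : Type*} [Group G] {B₁ B₂ N T : Subgroup G}
    (hT : ∀ t : N, (t : G) ∈ T → (t : G) ∈ B₂) (n : N) (x : G) :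
    x ∈ DoubleCoset' B₁ (T.subgroupOf N) (QuotientGroup.mk n : N ⧸ T.subgroupOf N) B₂ ↔
      ∃ c ∈ B₁, ∃ d ∈ B₂, x = c * n * d := by
  constructor
  · rintro ⟨c, hc, m, hm, d, hd, rfl⟩
    have ht : ((n⁻¹ * m : N) : G) ∈ B₂ :=
      hT _ (Subgroup.mem_subgroupOf.1 (QuotientGroup.eq.1 hm.symm))
    refine ⟨c, hc, _, B₂.mul_mem ht hd, ?_⟩
    push_cast
    group
  · rintro ⟨c, hc, d, hd, rfl⟩
    exact ⟨c, hc, n, rfl, d, hd, rfl⟩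

theorem image_eq_image_conj_iff {G : Type*} [Group G] (θ : G ≃* G) (hθ : ∀ x, θ (θ x) = x)
    (A B : Subgroup G) (g : G) :
    ⇑θ '' (A : Set G) = (fun y => g * y * g⁻¹) '' (B : Set G) ↔
      ∀ x, g⁻¹ * θ x * g ∈ B ↔ x ∈ A := by
  have hl : ∀ x, θ x ∈ ⇑θ '' (A : Set G) ↔ x ∈ A := fun x => by simp
  have hr : ∀ x, x ∈ (fun y => g * y * g⁻¹) '' (B : Set G) ↔ g⁻¹ * x * g ∈ B := by
    intro x
    constructor
    · rintro ⟨y, hy, rfl⟩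
      rw [show g⁻¹ * (g * y * g⁻¹) * g = y by group]
      exact hy
    · intro hx
      exact ⟨_, hx, by group⟩
  constructor
  · intro h x
    rw [← hr, ← h, hl]
  · intro h
    ext x
    rw [hr, ← hθ x, hl, h]

/-- Let `G` be a group with a saturated twin BN-pair `(B₊, B₋, N)` of type `(W,S)` with
`W = N/T`, `T = B₊ ∩ N = B₋ ∩ N`, such that every chamber fixed by `T` lies in the standard
twin apartment.  If `θ` is an automorphism of `G` with `θ ∘ θ = id` such that
`θ(B₊) = g B₋ g⁻¹` for some `g ∈ G`, then there exists `x ∈ G` with `θ(B₊) = x B₋ x⁻¹`,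
`θ(B₋) = x B₊ x⁻¹` and `θ(x)·x ∈ T`. -/
theorem twin_BN_pair_flip_normalizer
    {G : Type*} [Group G] {Bi : Type*}
    (Bp Bm N : Subgroup G)
    (hT : Bp ⊓ N = Bm ⊓ N)
    [hNorm : ((Bp ⊓ N).subgroupOf N).Normal]
    (M : CoxeterMatrix Bi) (cs : CoxeterSystem M (N ⧸ (Bp ⊓ N).subgroupOf N))
    -- `B_ε` and `N` generate `G`
    (hgen : ∀ Bε : Subgroup G, Bε = Bp ∨ Bε = Bm → Bε ⊔ N = ⊤)
    -- (BN1): `w B_ε s ⊆ B_ε ws B_ε ∪ B_ε w B_ε`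
    (hBN1 : ∀ Bε : Subgroup G, Bε = Bp ∨ Bε = Bm → ∀ n ns : N,
      (QuotientGroup.mk ns : N ⧸ (Bp ⊓ N).subgroupOf N) ∈ Set.range cs.simple →
      ∀ b ∈ Bε, (n : G) * b * ns ∈
        DoubleCoset' Bε ((Bp ⊓ N).subgroupOf N)
          ((QuotientGroup.mk n : N ⧸ (Bp ⊓ N).subgroupOf N) * QuotientGroup.mk ns) Bε ∪
        DoubleCoset' Bε ((Bp ⊓ N).subgroupOf N)
          (QuotientGroup.mk n : N ⧸ (Bp ⊓ N).subgroupOf N) Bε)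
    -- (BN2): `s B_ε s⁻¹ ⊄ B_ε`
    (hBN2 : ∀ Bε : Subgroup G, Bε = Bp ∨ Bε = Bm → ∀ ns : N,
      (QuotientGroup.mk ns : N ⧸ (Bp ⊓ N).subgroupOf N) ∈ Set.range cs.simple →
      ¬ ((fun x => (ns : G) * x * (ns : G)⁻¹) '' (Bε : Set G) ⊆ Bε))
    -- (TBN1): `B_ε w B_{−ε} s B_{−ε} = B_ε ws B_{−ε}` whenever `ℓ(ws) < ℓ(w)`
    (hTBN1 : ∀ B1 B2 : Subgroup G, (B1 = Bp ∧ B2 = Bm) ∨ (B1 = Bm ∧ B2 = Bp) →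
      ∀ n ns : N,
      (QuotientGroup.mk ns : N ⧸ (Bp ⊓ N).subgroupOf N) ∈ Set.range cs.simple →
      cs.length ((QuotientGroup.mk n : N ⧸ (Bp ⊓ N).subgroupOf N) * QuotientGroup.mk ns)
        < cs.length (QuotientGroup.mk n : N ⧸ (Bp ⊓ N).subgroupOf N) →
      {x | ∃ y ∈ DoubleCoset' B1 ((Bp ⊓ N).subgroupOf N)
              (QuotientGroup.mk n : N ⧸ (Bp ⊓ N).subgroupOf N) B2,
            ∃ b ∈ B2, x = y * ns * b} =
        DoubleCoset' B1 ((Bp ⊓ N).subgroupOf N)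
          ((QuotientGroup.mk n : N ⧸ (Bp ⊓ N).subgroupOf N) * QuotientGroup.mk ns) B2)
    -- (TBN2): `B₊ s ∩ B₋ = ∅`
    (hTBN2 : ∀ ns : N,
      (QuotientGroup.mk ns : N ⧸ (Bp ⊓ N).subgroupOf N) ∈ Set.range cs.simple →
      ∀ b ∈ Bp, b * (ns : G) ∉ Bm)
    -- saturation: `B₊ ∩ B₋ = T`
    (hsat : Bp ⊓ Bm = Bp ⊓ N)
    -- every chamber fixed by `T` lies in the standard twin apartment
    (hfix : ∀ Bε : Subgroup G, Bε = Bp ∨ Bε = Bm → ∀ g : G,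
      ((Bp ⊓ N : Subgroup G) : Set G) * (g • (Bε : Set G)) = g • (Bε : Set G) →
      ∃ n : N, g • (Bε : Set G) = (n : G) • (Bε : Set G))
    -- the involution θ
    (θ : G ≃* G) (hθ2 : ∀ g : G, θ (θ g) = g)
    (hθB : ∃ g : G, ⇑θ '' (Bp : Set G) = (fun y => g * y * g⁻¹) '' (Bm : Set G)) :
    ∃ x : G,
      ⇑θ '' (Bp : Set G) = (fun y => x * y * x⁻¹) '' (Bm : Set G) ∧
      ⇑θ '' (Bm : Set G) = (fun y => x * y * x⁻¹) '' (Bp : Set G) ∧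
      θ x * x ∈ Bp ⊓ N := by
  have memT : ∀ n : N, n ∈ (Bp ⊓ N).subgroupOf N ↔ (n : G) ∈ Bp := fun n => by
    simp [Subgroup.mem_subgroupOf]
  have mem_iff : ∀ n : N, (n : G) ∈ Bp ↔ (n : G) ∈ Bm := fun n => by
    have : (n : G) ∈ Bp ⊓ N ↔ (n : G) ∈ Bm ⊓ N := by rw [hT]
    simpa using this
  have mem_of_eps : ∀ B : Subgroup G, B = Bp ∨ B = Bm → ∀ n : N, (n : G) ∈ B ↔ (n : G) ∈ Bp := by
    rintro B (rfl | rfl) n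
    · rfl
    · exact (mem_iff n).symm
  have T_le : ∀ B : Subgroup G, B = Bp ∨ B = Bm → ∀ t : N, (t : G) ∈ Bp ⊓ N → (t : G) ∈ B :=
    fun B hB t ht => (mem_of_eps B hB t).2 ht.1
  let S : Set N := {s | (QuotientGroup.mk s : N ⧸ (Bp ⊓ N).subgroupOf N) ∈ Set.range cs.simple}
  have inv_mem : ∀ s ∈ S, s⁻¹ ∈ S := by
    rintro s ⟨i, hi⟩
    refine ⟨i, ?_⟩
    rw [QuotientGroup.mk_inv, ← hi, cs.inv_simple]
  have tits : ∀ B : Subgroup G, B = Bp ∨ B = Bm → IsTitsSystem B N S := by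
    intro B hB
    refine ⟨hgen B hB, ?_, inv_mem, ?_, ?_, ?_⟩
    · intro n t ht
      rw [mem_of_eps B hB, ← memT] at ht ⊢
      exact hNorm.conj_mem t ht n
    · intro P h1 hPT hPS n
      suffices ∀ w : N ⧸ (Bp ⊓ N).subgroupOf N, ∀ n : N,
          (QuotientGroup.mk n : N ⧸ (Bp ⊓ N).subgroupOf N) = w → P n from this _ n rfl
      intro w
      induction w using cs.simple_induction_right with
      | one =>
        intro n hn
        have := hPT 1 n ((mem_of_eps B hB n).2 ((memT n).1 ((QuotientGroup.eq_one_iff n).1 hn))) h1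
        rwa [one_mul] at this
      | mul_simple_right w i ih =>
        intro n hn
        obtain ⟨s, hs⟩ := QuotientGroup.mk_surjective (cs.simple i)
        have := hPS (n * s⁻¹) s ⟨i, hs.symm⟩ (ih _ (by
          rw [QuotientGroup.mk_mul, QuotientGroup.mk_inv, hn, hs, mul_inv_cancel_right]))
        rwa [inv_mul_cancel_right] at this
    · intro n s hs b hb
      have := hBN1 B hB n s hs b hb
      rw [← QuotientGroup.mk_mul] at this
      rcases this with h | h
      · left
        simpa using (mem_doubleCoset'_mk (T_le B hB) _ _).1 h
      · right
        exact (mem_doubleCoset'_mk (T_le B hB) _ _).1 h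
    · intro s hs
      by_contra! hcon
      refine hBN2 B hB s⁻¹ (inv_mem s hs) ?_
      rintro _ ⟨b, hb, rfl⟩
      simpa using hcon b hb
  have fixed : ∀ B : Subgroup G, B = Bp ∨ B = Bm → ∀ g : G,
      (∀ t : N, (t : G) ∈ Bp → g⁻¹ * t * g ∈ B) → ∃ n : N, (n : G)⁻¹ * g ∈ B := by
    intro B hB g hg
    obtain ⟨n, hn⟩ := hfix B hB g (by
      ext x
      constructor
      · rintro ⟨t, ht, y, hy, rfl⟩
        rw [Set.mem_smul_set_iff_inv_smul_mem, smul_eq_mul] at hy ⊢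
        have := B.mul_mem (hg ⟨t, ht.2⟩ ht.1) hy
        rw [show g⁻¹ * t * g * (g⁻¹ * y) = g⁻¹ * (t * y) by group] at this
        exact this
      · intro hx
        exact ⟨1, Subgroup.one_mem _, x, hx, one_mul x⟩)
    have hmem : g ∈ g • (B : Set G) := ⟨1, B.one_mem, by simp⟩
    rw [hn, Set.mem_smul_set_iff_inv_smul_mem, smul_eq_mul] at hmem
    exact ⟨n, hmem⟩
  have twin : IsSaturatedTwin Bp Bm N S
      (fun n => cs.length (QuotientGroup.mk n : N ⧸ (Bp ⊓ N).subgroupOf N)) := by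
    refine ⟨tits Bp (Or.inl rfl), tits Bm (Or.inr rfl), mem_iff, ?_, ?_, ?_, ?_, hTBN2,
      fixed Bp (Or.inl rfl), fixed Bm (Or.inr rfl)⟩
    · intro x hp hm
      have : x ∈ Bp ⊓ Bm := ⟨hp, hm⟩
      rw [hsat] at this
      exact this.2
    · rintro n s ⟨i, hi⟩
      simp only [QuotientGroup.mk_mul, ← hi]
      exact lt_or_gt_of_ne (cs.length_mul_simple_ne _ i)
    · intro n hn
      have hne : (QuotientGroup.mk n : N ⧸ (Bp ⊓ N).subgroupOf N) ≠ 1 := fun h =>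
        hn ((memT n).1 ((QuotientGroup.eq_one_iff n).1 h))
      obtain ⟨i, hi⟩ := cs.exists_rightDescent_of_ne_one hne
      obtain ⟨s, hs⟩ := QuotientGroup.mk_surjective (cs.simple i)
      refine ⟨s, ⟨i, hs.symm⟩, ?_⟩
      simp only [QuotientGroup.mk_mul, hs]
      exact hi
    · intro n s hs hl b hb
      simp only [QuotientGroup.mk_mul] at hl
      have h := hTBN1 Bp Bm (Or.inl ⟨rfl, rfl⟩) n s hs hl
      rw [← QuotientGroup.mk_mul] at h
      have hx : (n : G) * b * s ∈ DoubleCoset' Bp ((Bp ⊓ N).subgroupOf N)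
          (QuotientGroup.mk (n * s) : N ⧸ (Bp ⊓ N).subgroupOf N) Bm := by
        rw [← h]
        exact ⟨n * b, ⟨1, Bp.one_mem, n, rfl, b, hb, by simp⟩, 1, Bm.one_mem, by simp⟩
      simpa using (mem_doubleCoset'_mk (T_le Bm (Or.inr rfl)) _ _).1 hx
  obtain ⟨g, hg⟩ := hθB
  obtain ⟨x, hxp, hxm, hx⟩ := twin.exists_flip θ hθ2 ((image_eq_image_conj_iff θ hθ2 Bp Bm g).1 hg)
  exact ⟨x, (image_eq_image_conj_iff θ hθ2 Bp Bm x).2 hxp,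
    (image_eq_image_conj_iff θ hθ2 Bm Bp x).2 hxm, hx⟩
end

section
/- Let θ be an automorphism of G with θ ∘ θ = id such that θ(B₊) = gB₋g⁻¹ for some g ∈ G, and let x ∈ G satisfy θ(B₊) = xB₋x⁻¹ and θ(B₋) = xB₊x⁻¹. Then x⁻¹θ(T)x = T, x⁻¹θ(N)x = N, and the induced map θ_x : N/T → N/T, nT ↦ x⁻¹θ(n)x T, is a group automorphism of W = N/T satisfying θ_x(S) = S and θ_x ∘ θ_x = id; moreover θ_x does not depend on the choice of such x. -/
open scoped Pointwise

section DoubleCosets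

variable {G : Type*} [Group G] {B B1 B2 N : Subgroup G} {K : Subgroup N}

theorem coe_mem_doubleCoset' (n : N) :
    (n : G) ∈ DoubleCoset' B1 K (n : N ⧸ K) B2 :=
  ⟨1, B1.one_mem, n, rfl, 1, B2.one_mem, by simp⟩

theorem mul_mem_doubleCoset' {w : N ⧸ K} {b x : G} (hb : b ∈ B1)
    (hx : x ∈ DoubleCoset' B1 K w B2) : b * x ∈ DoubleCoset' B1 K w B2 := by
  obtain ⟨p, hp, n, hn, q, hq, rfl⟩ := hx
  exact ⟨b * p, B1.mul_mem hb hp, n, hn, q, hq, by group⟩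

theorem mem_doubleCoset'_mul {w : N ⧸ K} {b x : G} (hb : b ∈ B2)
    (hx : x ∈ DoubleCoset' B1 K w B2) : x * b ∈ DoubleCoset' B1 K w B2 := by
  obtain ⟨p, hp, n, hn, q, hq, rfl⟩ := hx
  exact ⟨p, hp, n, hn, q * b, B2.mul_mem hq hb, by group⟩

theorem mem_doubleCoset'_iff (hK : ∀ t ∈ K, (t : G) ∈ B2) {n : N} {x : G} :
    x ∈ DoubleCoset' B1 K (n : N ⧸ K) B2 ↔ ∃ b1 ∈ B1, ∃ b2 ∈ B2, x = b1 * n * b2 := by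
  constructor
  · rintro ⟨p, hp, m, hm, q, hq, rfl⟩
    have h := hK _ (QuotientGroup.eq.1 hm.symm)
    refine ⟨p, hp, _, B2.mul_mem h hq, ?_⟩
    push_cast
    group
  · rintro ⟨p, hp, q, hq, rfl⟩
    exact ⟨p, hp, n, rfl, q, hq, rfl⟩

theorem mem_doubleCoset'_one_iff (hK : ∀ t ∈ K, (t : G) ∈ B2) [K.Normal] {x : G} :
    x ∈ DoubleCoset' B1 K 1 B2 ↔ ∃ b1 ∈ B1, ∃ b2 ∈ B2, x = b1 * b2 := by
  rw [← QuotientGroup.mk_one, mem_doubleCoset'_iff hK]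
  simp

theorem inv_mem_doubleCoset' [K.Normal] {w : N ⧸ K} {x : G}
    (hx : x ∈ DoubleCoset' B1 K w B2) : x⁻¹ ∈ DoubleCoset' B2 K w⁻¹ B1 := by
  obtain ⟨p, hp, n, rfl, q, hq, rfl⟩ := hx
  exact ⟨q⁻¹, B2.inv_mem hq, n⁻¹, rfl, p⁻¹, B1.inv_mem hp, by push_cast; group⟩

end DoubleCosets

/-- `(B, N)` is a BN-pair with `K = B ∩ N`, with respect to a given Coxeter system on `N ⧸ K`
(generation of `G` by `B` and `N` is not required). -/
structure IsTitsSystem_s5 {G : Type*} [Group G] {Bi : Type*} {M : CoxeterMatrix Bi} (B : Subgroup G)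
    {N : Subgroup G} {K : Subgroup N} [K.Normal] (cs : CoxeterSystem M (N ⧸ K)) : Prop where
  mem_iff : ∀ t : N, t ∈ K ↔ (t : G) ∈ B
  mul_mul_mem : ∀ n ns : N, (ns : N ⧸ K) ∈ Set.range cs.simple → ∀ b ∈ B,
    (n : G) * b * ns ∈ DoubleCoset' B K ((n : N ⧸ K) * (ns : N ⧸ K)) B ∪
      DoubleCoset' B K (n : N ⧸ K) B
  not_image_subset : ∀ ns : N, (ns : N ⧸ K) ∈ Set.range cs.simple →
    ¬ ((fun x => (ns : G) * x * (ns : G)⁻¹) '' (B : Set G) ⊆ B)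

namespace IsTitsSystem_s5

variable {G : Type*} [Group G] {Bi : Type*} {M : CoxeterMatrix Bi} {B N : Subgroup G}
  {K : Subgroup N} [K.Normal] {cs : CoxeterSystem M (N ⧸ K)}

theorem coe_mem (h : IsTitsSystem_s5 B cs) : ∀ t ∈ K, (t : G) ∈ B := fun t => (h.mem_iff t).1

theorem mem_one_iff (h : IsTitsSystem_s5 B cs) {x : G} : x ∈ DoubleCoset' B K 1 B ↔ x ∈ B := by
  rw [mem_doubleCoset'_one_iff h.coe_mem]
  constructor
  · rintro ⟨p, hp, q, hq, rfl⟩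
    exact B.mul_mem hp hq
  · exact fun hx => ⟨x, hx, 1, B.one_mem, by simp⟩

theorem mul_mem_or (h : IsTitsSystem_s5 B cs) (w : N ⧸ K) (i : Bi) {x y : G}
    (hx : x ∈ DoubleCoset' B K w B) (hy : y ∈ DoubleCoset' B K (cs.simple i) B) :
    x * y ∈ DoubleCoset' B K (w * cs.simple i) B ∨ x * y ∈ DoubleCoset' B K w B := by
  obtain ⟨p, hp, n, rfl, q, hq, rfl⟩ := hx
  obtain ⟨p', hp', m, hm, q', hq', rfl⟩ := hy
  have e : p * n * q * (p' * m * q') = p * (n * (q * p') * m) * q' := by group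
  rw [e, ← hm]
  exact (h.mul_mul_mem n m ⟨i, hm.symm⟩ _ (B.mul_mem hq hp')).imp
    (fun k => mem_doubleCoset'_mul hq' (mul_mem_doubleCoset' hp k))
    (fun k => mem_doubleCoset'_mul hq' (mul_mem_doubleCoset' hp k))

theorem simple_mul_mem_or (h : IsTitsSystem_s5 B cs) (w : N ⧸ K) (i : Bi) {x y : G}
    (hx : x ∈ DoubleCoset' B K (cs.simple i) B) (hy : y ∈ DoubleCoset' B K w B) :
    x * y ∈ DoubleCoset' B K (cs.simple i * w) B ∨ x * y ∈ DoubleCoset' B K w B := by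
  have hx' := inv_mem_doubleCoset' hx
  rw [cs.inv_simple] at hx'
  refine (h.mul_mem_or _ i (inv_mem_doubleCoset' hy) hx').imp (fun k => ?_) (fun k => ?_)
  · simpa using inv_mem_doubleCoset' k
  · simpa using inv_mem_doubleCoset' k

/-- Distinct elements of `N ⧸ K` have disjoint double cosets. -/
theorem eq_of_mem_of_mem (h : IsTitsSystem_s5 B cs) {w w' : N ⧸ K} {x : G}
    (hx : x ∈ DoubleCoset' B K w B) (hx' : x ∈ DoubleCoset' B K w' B) : w = w' := by
  wlog hle : cs.length w ≤ cs.length w' generalizing w w'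
  · exact (this hx' hx (le_of_not_ge hle)).symm
  induction hk : cs.length w using Nat.strong_induction_on generalizing w w' x with
  | _ k ih =>
    subst hk
    by_cases hw : w = 1
    · subst hw
      rw [h.mem_one_iff] at hx
      obtain ⟨p, hp, n, rfl, q, hq, rfl⟩ := hx'
      symm
      rw [QuotientGroup.eq_one_iff, h.mem_iff]
      have := B.mul_mem (B.mul_mem (B.inv_mem hp) hx) (B.inv_mem hq)
      simpa [mul_assoc] using this
    · obtain ⟨i, hi⟩ := cs.exists_leftDescent_of_ne_one hw
      rw [cs.isLeftDescent_iff] at hi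
      obtain ⟨p, hp, n, rfl, q, hq, rfl⟩ := hx
      obtain ⟨m, hm⟩ := QuotientGroup.mk_surjective (cs.simple i)
      have hn : (n : G) ∈ DoubleCoset' B K w' B := by
        have := mul_mem_doubleCoset' (B.inv_mem hp) (mem_doubleCoset'_mul (B.inv_mem hq) hx')
        simpa [mul_assoc] using this
      have h1 : (m : G) * n ∈ DoubleCoset' B K (cs.simple i * (n : N ⧸ K)) B := by
        rw [← hm]
        exact coe_mem_doubleCoset' (m * n)
      have h2 := h.simple_mul_mem_or w' i (hm ▸ coe_mem_doubleCoset' m) hn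
      have hlen := cs.length_simple_mul w' i
      rcases h2 with h2 | h2
      · exact mul_left_cancel (ih _ (by lia) h1 h2 (by lia) rfl)
      · have := ih _ (by lia) h1 h2 (by lia) rfl
        rw [← this] at hle
        lia

theorem mul_mem_of_length_lt (h : IsTitsSystem_s5 B cs) {w : N ⧸ K} {i : Bi}
    (hl : cs.length w < cs.length (w * cs.simple i)) {x y : G}
    (hx : x ∈ DoubleCoset' B K w B) (hy : y ∈ DoubleCoset' B K (cs.simple i) B) :
    x * y ∈ DoubleCoset' B K (w * cs.simple i) B := by
  induction hk : cs.length w using Nat.strong_induction_on generalizing w x y with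
  | _ k ih =>
    subst hk
    by_cases hw : w = 1
    · subst hw
      rw [h.mem_one_iff] at hx
      simpa using mul_mem_doubleCoset' hx hy
    · obtain ⟨j, hj⟩ := cs.exists_leftDescent_of_ne_one hw
      rw [cs.isLeftDescent_iff] at hj
      refine (h.mul_mem_or w i hx hy).resolve_right fun hxy => ?_
      obtain ⟨p, hp, n, rfl, q, hq, rfl⟩ := hx
      obtain ⟨m, hm⟩ := QuotientGroup.mk_surjective (cs.simple j)
      have h1 : (m : G) * n * q ∈ DoubleCoset' B K (cs.simple j * (n : N ⧸ K)) B := by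
        rw [← hm]
        exact mem_doubleCoset'_mul hq (coe_mem_doubleCoset' (m * n))
      have hlen := cs.length_simple_mul ((n : N ⧸ K) * cs.simple i) j
      have hlt : cs.length (cs.simple j * (n : N ⧸ K)) <
          cs.length (cs.simple j * (n : N ⧸ K) * cs.simple i) := by
        rw [mul_assoc]
        lia
      have h2 := ih _ (by lia) hlt h1 hy rfl
      have h3 := h.simple_mul_mem_or _ j (hm ▸ coe_mem_doubleCoset' m)
        (mul_mem_doubleCoset' (B.inv_mem hp) hxy)
      have e : (m : G) * (p⁻¹ * (p * n * q * y)) = m * n * q * y := by group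
      rw [e] at h3
      rcases h3 with h3 | h3
      · rw [h.eq_of_mem_of_mem h2 h3] at hlt
        exact lt_irrefl _ hlt
      · have := h.eq_of_mem_of_mem h2 h3
        have e' : (n : N ⧸ K) * cs.simple i = cs.simple j * n := by
          rw [← cs.simple_mul_simple_cancel_left (w := (n : N ⧸ K) * cs.simple i) j,
            ← mul_assoc _ _ (cs.simple i),
            this]
        rw [e'] at hl
        lia

theorem exists_conj_eq (h : IsTitsSystem_s5 B cs) {ns : N}
    (hs : (ns : N ⧸ K) ∈ Set.range cs.simple) :
    ∃ b ∈ B, ∃ b1 ∈ B, ∃ b2 ∈ B, (ns : G) * b * ns = b1 * ns * b2 := by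
  obtain ⟨y, ⟨b, hb, rfl⟩, hy⟩ := Set.not_subset.1 (h.not_image_subset ns hs)
  refine ⟨b, hb, ?_⟩
  have hsq : (ns : N ⧸ K) * ns = 1 := by
    obtain ⟨i, hi⟩ := hs
    rw [← hi, cs.simple_mul_simple_self]
  rcases h.mul_mul_mem ns ns hs b hb with h1 | h1
  · rw [hsq, h.mem_one_iff] at h1
    refine absurd ?_ hy
    have h2 : ((ns * ns : N) : G) ∈ B := h.coe_mem _ ((QuotientGroup.eq_one_iff _).1 hsq)
    have := B.mul_mem h1 (B.inv_mem h2)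
    push_cast at this
    simpa [mul_assoc] using this
  · exact (mem_doubleCoset'_iff h.coe_mem).1 h1

/-- An involution `w ≠ 1` for which `B ∪ B w B` is closed under products is a simple reflection. -/
theorem mem_range_simple (h : IsTitsSystem_s5 B cs) {n : N} (hn : (n : N ⧸ K) ≠ 1)
    (hsq : (n : N ⧸ K) * n = 1)
    (hmul : ∀ b ∈ B, (n : G) * b * n ∈ B ∨ (n : G) * b * n ∈ DoubleCoset' B K (n : N ⧸ K) B) :
    (n : N ⧸ K) ∈ Set.range cs.simple := by
  obtain ⟨i, hi⟩ := cs.exists_rightDescent_of_ne_one hn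
  refine ⟨i, ?_⟩
  obtain ⟨r, hr⟩ := QuotientGroup.mk_surjective (cs.simple i)
  obtain ⟨b, hb, b1, hb1, b2, hb2, e⟩ := h.exists_conj_eq (ns := r) ⟨i, hr.symm⟩
  have hi' : cs.length ((n : N ⧸ K) * cs.simple i) <
      cs.length ((n : N ⧸ K) * cs.simple i * cs.simple i) := by
    rw [cs.simple_mul_simple_cancel_right]
    exact hi
  have hv : ((n * r⁻¹ : N) : G) * b1 ∈ DoubleCoset' B K ((n : N ⧸ K) * cs.simple i) B := by
    rw [← cs.inv_simple, ← hr]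
    exact mem_doubleCoset'_mul hb1 (coe_mem_doubleCoset' (n * r⁻¹))
  have h1 := h.mul_mem_of_length_lt hi' hv (hr ▸ coe_mem_doubleCoset' r)
  rw [cs.simple_mul_simple_cancel_right] at h1
  have h2 := mem_doubleCoset'_mul hb2 h1
  have e2 : ((n * r⁻¹ : N) : G) * b1 * r * b2 = n * b * r := by
    push_cast
    rw [mul_assoc, mul_assoc, ← mul_assoc b1, ← e]
    group
  rw [e2, mem_doubleCoset'_iff h.coe_mem] at h2
  obtain ⟨c1, hc1, c2, hc2, e3⟩ := h2
  have ht : ((n * n : N) : G) ∈ B := h.coe_mem _ ((QuotientGroup.eq_one_iff _).1 hsq)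
  push_cast at ht
  have e4 : (r : G) = b⁻¹ * (n * n : G)⁻¹ * (n * c1 * n) * c2 := by
    have : (r : G) = (n * b : G)⁻¹ * (n * b * r) := by group
    rw [this, e3]
    group
  have hl : b⁻¹ * (n * n : G)⁻¹ ∈ B := B.mul_mem (B.inv_mem hb) (B.inv_mem ht)
  have hrC : (r : G) ∈ DoubleCoset' B K (cs.simple i) B := hr ▸ coe_mem_doubleCoset' r
  rcases hmul c1 hc1 with h5 | h5
  · have h6 : (r : G) ∈ B := by
      rw [e4]
      exact B.mul_mem (B.mul_mem hl h5) hc2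
    have := h.eq_of_mem_of_mem hrC (h.mem_one_iff.2 h6)
    have h7 := cs.length_simple i
    rw [this, cs.length_one] at h7
    lia
  · refine h.eq_of_mem_of_mem hrC ?_
    rw [e4]
    exact mem_doubleCoset'_mul hc2 (mul_mem_doubleCoset' hl h5)

end IsTitsSystem_s5

/-- The axioms relating the two halves of a twin BN-pair, for one choice of signs. -/
structure IsTwinTitsSystem {G : Type*} [Group G] {Bi : Type*} {M : CoxeterMatrix Bi}
    (B1 B2 : Subgroup G) {N : Subgroup G} {K : Subgroup N} [K.Normal]
    (cs : CoxeterSystem M (N ⧸ K)) : Prop where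
  right : IsTitsSystem_s5 B2 cs
  mul_eq : ∀ n ns : N, (ns : N ⧸ K) ∈ Set.range cs.simple →
    cs.length ((n : N ⧸ K) * (ns : N ⧸ K)) < cs.length (n : N ⧸ K) →
    {x | ∃ y ∈ DoubleCoset' B1 K (n : N ⧸ K) B2, ∃ b ∈ B2, x = y * ns * b} =
      DoubleCoset' B1 K ((n : N ⧸ K) * (ns : N ⧸ K)) B2
  notMem : ∀ ns : N, (ns : N ⧸ K) ∈ Set.range cs.simple → ∀ b ∈ B1, b * (ns : G) ∉ B2

namespace IsTwinTitsSystem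

variable {G : Type*} [Group G] {Bi : Type*} {M : CoxeterMatrix Bi} {B1 B2 N : Subgroup G}
  {K : Subgroup N} [K.Normal] {cs : CoxeterSystem M (N ⧸ K)}

theorem exists_mul_mul_eq (h : IsTwinTitsSystem B1 B2 cs) {ns : N}
    (hs : (ns : N ⧸ K) ∈ Set.range cs.simple) :
    ∃ b1 ∈ B2, ∃ b2 ∈ B2, ∃ p ∈ B1, ∃ q ∈ B2, b1 * ns * b2 = p * q := by
  obtain ⟨b, hb, b1, hb1, b2, hb2, e⟩ := h.right.exists_conj_eq hs
  refine ⟨b1, hb1, b2, hb2, ?_⟩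
  rw [← mem_doubleCoset'_one_iff h.right.coe_mem (B1 := B1), ← e]
  have hsq : (ns : N ⧸ K) * ns = 1 := by
    obtain ⟨i, hi⟩ := hs
    rw [← hi, cs.simple_mul_simple_self]
  have hlt : cs.length ((ns : N ⧸ K) * ns) < cs.length (ns : N ⧸ K) := by
    obtain ⟨i, hi⟩ := hs
    rw [hsq, ← hi]
    simp
  rw [← hsq, ← h.mul_eq ns ns hs hlt]
  exact ⟨ns * b, mem_doubleCoset'_mul hb (coe_mem_doubleCoset' ns), 1, B2.one_mem, by simp⟩

/-- If `n ∈ B₁ B₂` then `n` represents the identity. -/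
theorem mem_of_eq_mul (h : IsTwinTitsSystem B1 B2 cs) {n : N} {p q : G} (hp : p ∈ B1)
    (hq : q ∈ B2) (e : (n : G) = p * q) : n ∈ K := by
  rw [← QuotientGroup.eq_one_iff]
  by_contra hn
  obtain ⟨i, hi⟩ := cs.exists_rightDescent_of_ne_one hn
  obtain ⟨s, hs⟩ := QuotientGroup.mk_surjective (cs.simple i)
  have hs' : (s : N ⧸ K) ∈ Set.range cs.simple := ⟨i, hs.symm⟩
  rw [CoxeterSystem.IsRightDescent, ← hs] at hi
  have hA := h.mul_eq n s hs' hi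
  have hy : ∀ b ∈ B2, b ∈ DoubleCoset' B1 K (n : N ⧸ K) B2 := fun b hb => by
    rw [mem_doubleCoset'_iff h.right.coe_mem]
    exact ⟨p⁻¹, B1.inv_mem hp, q⁻¹ * b, B2.mul_mem (B2.inv_mem hq) hb, by rw [e]; group⟩
  obtain ⟨b1, hb1, b2, hb2, p', hp', q', hq', e'⟩ := h.exists_mul_mul_eq hs'
  have h1 : (s : G) ∈ DoubleCoset' B1 K ((n : N ⧸ K) * (s : N ⧸ K)) B2 := by
    rw [← hA]
    exact ⟨1, hy 1 B2.one_mem, 1, B2.one_mem, by simp⟩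
  have h2 : p' * q' ∈ DoubleCoset' B1 K ((n : N ⧸ K) * (s : N ⧸ K)) B2 := by
    rw [← hA]
    exact ⟨b1, hy b1 hb1, b2, hb2, e'.symm⟩
  rw [← QuotientGroup.mk_mul, mem_doubleCoset'_iff h.right.coe_mem] at h1 h2
  obtain ⟨c1, hc1, c2, hc2, e1⟩ := h1
  obtain ⟨d1, hd1, d2, hd2, e2⟩ := h2
  refine h.notMem s hs' (p'⁻¹ * d1 * c1⁻¹)
    (B1.mul_mem (B1.mul_mem (B1.inv_mem hp') hd1) (B1.inv_mem hc1)) ?_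
  have e3 : p'⁻¹ * d1 * c1⁻¹ * s = q' * d2⁻¹ * c2 := by
    have : q' = p'⁻¹ * (d1 * ((n * s : N) : G) * d2) := by rw [← e2]; group
    rw [this, e1]
    group
  rw [e3]
  exact B2.mul_mem (B2.mul_mem hq' (B2.inv_mem hd2)) hc2

/-- An element `n ∈ N` with `n⁻¹ B₁ n ⊆ B₁` represents the identity. -/
theorem mem_of_inv_mul_mul_mem (h : IsTwinTitsSystem B1 B2 cs) {n : N}
    (hn : ∀ b ∈ B1, (n : G)⁻¹ * b * n ∈ B1) : n ∈ K := by
  rw [← QuotientGroup.eq_one_iff]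
  by_contra hn1
  obtain ⟨i, hi⟩ := cs.exists_rightDescent_of_ne_one hn1
  obtain ⟨s, hs⟩ := QuotientGroup.mk_surjective (cs.simple i)
  have hs' : (s : N ⧸ K) ∈ Set.range cs.simple := ⟨i, hs.symm⟩
  rw [CoxeterSystem.IsRightDescent, ← hs] at hi
  have hA := h.mul_eq n s hs' hi
  obtain ⟨b1, hb1, b2, hb2, p', hp', q', hq', e'⟩ := h.exists_mul_mul_eq hs'
  have h2 : n * (p' * q') ∈ DoubleCoset' B1 K ((n : N ⧸ K) * (s : N ⧸ K)) B2 := by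
    rw [← hA]
    exact ⟨n * b1, mem_doubleCoset'_mul hb1 (coe_mem_doubleCoset' n), b2, hb2, by
      rw [← e']; group⟩
  rw [← QuotientGroup.mk_mul, mem_doubleCoset'_iff h.right.coe_mem] at h2
  obtain ⟨d1, hd1, d2, hd2, e2⟩ := h2
  refine h.notMem s hs' (p'⁻¹ * ((n : G)⁻¹ * d1 * n))
    (B1.mul_mem (B1.inv_mem hp') (hn d1 hd1)) ?_
  have e3 : p'⁻¹ * ((n : G)⁻¹ * d1 * n) * s = q' * d2⁻¹ := by
    have : q' = p'⁻¹ * ((n : G)⁻¹ * (d1 * ((n * s : N) : G) * d2)) := by rw [← e2]; group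
    rw [this]
    push_cast
    group
  rw [e3]
  exact B2.mul_mem hq' (B2.inv_mem hd2)

end IsTwinTitsSystem

/-- Let `G` be a group with a saturated twin BN-pair `(B₊, B₋, N)` of type `(W,S)` with
`W = N/T`, `T = B₊ ∩ N = B₋ ∩ N`, such that every chamber fixed by `T` lies in the standard
twin apartment.  Let `θ` be an automorphism of `G` with `θ ∘ θ = id` such that
`θ(B₊) = x B₋ x⁻¹` and `θ(B₋) = x B₊ x⁻¹` for some `x ∈ G`.  Then `x⁻¹θ(T)x = T`,
`x⁻¹θ(N)x = N`, and the induced map `θ_x : N/T → N/T`, `nT ↦ x⁻¹θ(n)x T`, is a group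
automorphism of `W = N/T` with `θ_x(S) = S` and `θ_x ∘ θ_x = id`, independent of the
choice of such `x`. -/
theorem twin_BN_pair_flip_induced_Weyl_automorphism
    {G : Type*} [Group G] {Bi : Type*}
    (Bp Bm N : Subgroup G)
    (hT : Bp ⊓ N = Bm ⊓ N)
    [hNorm : ((Bp ⊓ N).subgroupOf N).Normal]
    (M : CoxeterMatrix Bi) (cs : CoxeterSystem M (N ⧸ (Bp ⊓ N).subgroupOf N))
    -- `B_ε` and `N` generate `G`
    (hgen : ∀ Bε : Subgroup G, Bε = Bp ∨ Bε = Bm → Bε ⊔ N = ⊤)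
    -- (BN1): `w B_ε s ⊆ B_ε ws B_ε ∪ B_ε w B_ε`
    (hBN1 : ∀ Bε : Subgroup G, Bε = Bp ∨ Bε = Bm → ∀ n ns : N,
      (QuotientGroup.mk ns : N ⧸ (Bp ⊓ N).subgroupOf N) ∈ Set.range cs.simple →
      ∀ b ∈ Bε, (n : G) * b * ns ∈
        DoubleCoset' Bε ((Bp ⊓ N).subgroupOf N)
          ((QuotientGroup.mk n : N ⧸ (Bp ⊓ N).subgroupOf N) * QuotientGroup.mk ns) Bε ∪
        DoubleCoset' Bε ((Bp ⊓ N).subgroupOf N)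
          (QuotientGroup.mk n : N ⧸ (Bp ⊓ N).subgroupOf N) Bε)
    -- (BN2): `s B_ε s⁻¹ ⊄ B_ε`
    (hBN2 : ∀ Bε : Subgroup G, Bε = Bp ∨ Bε = Bm → ∀ ns : N,
      (QuotientGroup.mk ns : N ⧸ (Bp ⊓ N).subgroupOf N) ∈ Set.range cs.simple →
      ¬ ((fun x => (ns : G) * x * (ns : G)⁻¹) '' (Bε : Set G) ⊆ Bε))
    -- (TBN1): `B_ε w B_{−ε} s B_{−ε} = B_ε ws B_{−ε}` whenever `ℓ(ws) < ℓ(w)`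
    (hTBN1 : ∀ B1 B2 : Subgroup G, (B1 = Bp ∧ B2 = Bm) ∨ (B1 = Bm ∧ B2 = Bp) →
      ∀ n ns : N,
      (QuotientGroup.mk ns : N ⧸ (Bp ⊓ N).subgroupOf N) ∈ Set.range cs.simple →
      cs.length ((QuotientGroup.mk n : N ⧸ (Bp ⊓ N).subgroupOf N) * QuotientGroup.mk ns)
        < cs.length (QuotientGroup.mk n : N ⧸ (Bp ⊓ N).subgroupOf N) →
      {x | ∃ y ∈ DoubleCoset' B1 ((Bp ⊓ N).subgroupOf N)
              (QuotientGroup.mk n : N ⧸ (Bp ⊓ N).subgroupOf N) B2,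
            ∃ b ∈ B2, x = y * ns * b} =
        DoubleCoset' B1 ((Bp ⊓ N).subgroupOf N)
          ((QuotientGroup.mk n : N ⧸ (Bp ⊓ N).subgroupOf N) * QuotientGroup.mk ns) B2)
    -- (TBN2): `B₊ s ∩ B₋ = ∅`
    (hTBN2 : ∀ ns : N,
      (QuotientGroup.mk ns : N ⧸ (Bp ⊓ N).subgroupOf N) ∈ Set.range cs.simple →
      ∀ b ∈ Bp, b * (ns : G) ∉ Bm)
    -- saturation: `B₊ ∩ B₋ = T`
    (hsat : Bp ⊓ Bm = Bp ⊓ N)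
    -- every chamber fixed by `T` lies in the standard twin apartment
    (hfix : ∀ Bε : Subgroup G, Bε = Bp ∨ Bε = Bm → ∀ g : G,
      ((Bp ⊓ N : Subgroup G) : Set G) * (g • (Bε : Set G)) = g • (Bε : Set G) →
      ∃ n : N, g • (Bε : Set G) = (n : G) • (Bε : Set G))
    -- the involution θ and the element x
    (θ : G ≃* G) (hθ2 : ∀ g : G, θ (θ g) = g)
    (x : G)
    (hxp : ⇑θ '' (Bp : Set G) = (fun y => x * y * x⁻¹) '' (Bm : Set G))
    (hxm : ⇑θ '' (Bm : Set G) = (fun y => x * y * x⁻¹) '' (Bp : Set G)) :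
    ((fun g => x⁻¹ * θ g * x) '' ((Bp ⊓ N : Subgroup G) : Set G)
        = ((Bp ⊓ N : Subgroup G) : Set G)) ∧
    ((fun g => x⁻¹ * θ g * x) '' (N : Set G) = (N : Set G)) ∧
    ∃ φ : (N ⧸ (Bp ⊓ N).subgroupOf N) ≃* (N ⧸ (Bp ⊓ N).subgroupOf N),
      (∀ n m : N, (m : G) = x⁻¹ * θ n * x →
        φ (QuotientGroup.mk n) = QuotientGroup.mk m) ∧
      ⇑φ '' Set.range cs.simple = Set.range cs.simple ∧
      (∀ w, φ (φ w) = w) ∧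
      (∀ x' : G,
        ⇑θ '' (Bp : Set G) = (fun y => x' * y * x'⁻¹) '' (Bm : Set G) →
        ⇑θ '' (Bm : Set G) = (fun y => x' * y * x'⁻¹) '' (Bp : Set G) →
        ∀ n m : N, (m : G) = x'⁻¹ * θ n * x' →
          φ (QuotientGroup.mk n) = QuotientGroup.mk m) := by
  have hrfl : ∀ t : N, t ∈ (Bp ⊓ N).subgroupOf N ↔ (t : G) ∈ Bp := fun t => by
    simp [Subgroup.mem_subgroupOf]
  have hTits : ∀ Bε : Subgroup G, Bε = Bp ∨ Bε = Bm → IsTitsSystem_s5 Bε cs := fun Bε h =>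
    { mem_iff := by
        rcases h with rfl | rfl
        · exact hrfl
        · intro t
          rw [Subgroup.mem_subgroupOf, hT]
          simp
      mul_mul_mem := hBN1 Bε h
      not_image_subset := hBN2 Bε h }
  have hm := hTits Bm (Or.inr rfl)
  have htw : IsTwinTitsSystem Bp Bm cs :=
    { right := hm
      mul_eq := hTBN1 Bp Bm (Or.inl ⟨rfl, rfl⟩)
      notMem := hTBN2 }
  have hTN : ∀ n ∈ N, ∀ t ∈ Bp ⊓ N, n⁻¹ * t * n ∈ Bp ⊓ N := fun n hn t ht => by
    have := hNorm.conj_mem ⟨t, ht.2⟩ ((hrfl _).2 ht.1) ⟨n⁻¹, N.inv_mem hn⟩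
    simpa using Subgroup.mem_subgroupOf.1 this
  have hNT : ∀ g : G, (∀ t ∈ Bp ⊓ N, g⁻¹ * t * g ∈ Bp ⊓ N) → g ∈ N := fun g hg => by
    have hg' : ∀ Bε : Subgroup G, Bε = Bp ∨ Bε = Bm → ∃ n : N, (n : G)⁻¹ * g ∈ Bε := by
      intro Bε h
      have hle : Bp ⊓ N ≤ Bε := by
        rcases h with rfl | rfl
        · exact inf_le_left
        · rw [hT]
          exact inf_le_left
      obtain ⟨n, hn⟩ := hfix Bε h g (by
        ext y
        rw [Set.mem_mul]
        constructor
        · rintro ⟨t, ht, _, ⟨b, hb, rfl⟩, rfl⟩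
          refine ⟨g⁻¹ * t * g * b, Bε.mul_mem (hle (hg t ht)) hb, ?_⟩
          simp [mul_assoc]
        · exact fun hy => ⟨1, Subgroup.one_mem _, y, hy, one_mul y⟩)
      refine ⟨n, ?_⟩
      have : g ∈ (n : G) • (Bε : Set G) := hn ▸ ⟨1, Bε.one_mem, by simp⟩
      simpa [Set.mem_smul_set_iff_inv_smul_mem] using this
    obtain ⟨n, hn⟩ := hg' Bp (Or.inl rfl)
    obtain ⟨m, hm'⟩ := hg' Bm (Or.inr rfl)
    have hK := htw.mem_of_eq_mul (n := n⁻¹ * m) hn (Bm.inv_mem hm') (by push_cast; group)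
    have h1 : (n : G)⁻¹ * g ∈ Bp ⊓ Bm := by
      refine ⟨hn, ?_⟩
      have := Bm.mul_mem (hm.coe_mem _ hK) hm'
      push_cast at this
      simpa [mul_assoc] using this
    rw [hsat] at h1
    simpa using N.mul_mem n.2 h1.2
  have hnorm : ∀ c : G, (∀ b ∈ Bp, c⁻¹ * b * c ∈ Bp) → (∀ b ∈ Bm, c⁻¹ * b * c ∈ Bm) →
      c ∈ Bp ⊓ N := fun c h1 h3 => by
    have hc : c ∈ N := hNT c fun t ht => by
      rw [← hsat] at ht ⊢
      exact ⟨h1 t ht.1, h3 t ht.2⟩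
    exact ⟨(hrfl ⟨c, hc⟩).1 (htw.mem_of_inv_mul_mul_mem h1), hc⟩
  have hconj : ∀ c ∈ Bp ⊓ N, ∀ n m : N, (m : G) = c⁻¹ * n * c →
      (QuotientGroup.mk n : N ⧸ (Bp ⊓ N).subgroupOf N) = QuotientGroup.mk m := by
    intro c hc n m e
    have hcK : (⟨c, hc.2⟩ : N) ∈ (Bp ⊓ N).subgroupOf N := (hrfl _).2 hc.1
    have e' : m = (⟨c, hc.2⟩ : N)⁻¹ * n * ⟨c, hc.2⟩ := Subtype.ext e
    rw [e', QuotientGroup.mk_mul, QuotientGroup.mk_mul, QuotientGroup.mk_inv,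
      (QuotientGroup.eq_one_iff _).2 hcK]
    simp
  have hflip : ∀ y : G, ∀ B1 B2 : Subgroup G,
      ⇑θ '' (B1 : Set G) = (fun z => y * z * y⁻¹) '' (B2 : Set G) →
      ∀ b, y⁻¹ * θ b * y ∈ B2 ↔ b ∈ B1 := by
    intro y B1 B2 h b
    rw [← SetLike.mem_coe (p := B1), ← θ.injective.mem_set_image, h]
    constructor
    · exact fun hb => ⟨_, hb, by group⟩
    · rintro ⟨z, hz, e⟩
      rw [← e]
      simpa [mul_assoc] using hz
  let ψ : G ≃* G := θ.trans (MulAut.conj x⁻¹)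
  have hψ : ∀ g, ψ g = x⁻¹ * θ g * x := fun g => by simp [ψ]
  have hψp : ∀ b, ψ b ∈ Bm ↔ b ∈ Bp := fun b => by rw [hψ]; exact hflip x _ _ hxp b
  have hψm : ∀ b, ψ b ∈ Bp ↔ b ∈ Bm := fun b => by rw [hψ]; exact hflip x _ _ hxm b
  have hψT : ∀ b, ψ b ∈ Bp ⊓ N ↔ b ∈ Bp ⊓ N := fun b => by
    rw [← hsat, Subgroup.mem_inf, Subgroup.mem_inf, hψp, hψm, and_comm]
  have hψN : ∀ b, ψ b ∈ N ↔ b ∈ N := fun b => by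
    constructor
    · intro h
      refine hNT b fun t ht => ?_
      rw [← hψT] at ht ⊢
      simpa using hTN _ h _ ht
    · intro h
      refine hNT _ fun t ht => ?_
      obtain ⟨u, rfl⟩ := ψ.surjective t
      rw [hψT] at ht
      have := (hψT _).2 (hTN _ h _ ht)
      simpa using this
  have himg : ∀ H : Subgroup G, (∀ b, ψ b ∈ H ↔ b ∈ H) →
      (fun g => x⁻¹ * θ g * x) '' (H : Set G) = (H : Set G) := fun H h => by
    rw [← funext hψ]
    ext y
    obtain ⟨u, rfl⟩ := ψ.surjective y
    rw [ψ.injective.mem_set_image]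
    exact (h u).symm
  refine ⟨himg _ hψT, himg _ hψN, ?_⟩
  have hmap : N.map (ψ : G →* G) = N := SetLike.coe_injective (by
    rw [← himg N hψN, ← funext hψ]
    rfl)
  let e : N ≃* N := (ψ.subgroupMap N).trans (MulEquiv.subgroupCongr hmap)
  have he : ∀ n : N, (e n : G) = ψ n := fun n => rfl
  have heK : ((Bp ⊓ N).subgroupOf N).map (e : N →* N) = (Bp ⊓ N).subgroupOf N := by
    ext t
    obtain ⟨u, rfl⟩ := e.surjective t
    rw [Subgroup.mem_map]
    constructor
    · rintro ⟨v, hv, hvu⟩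
      obtain rfl : v = u := e.injective hvu
      rw [Subgroup.mem_subgroupOf] at hv ⊢
      rwa [he, hψT]
    · intro h
      refine ⟨u, ?_, rfl⟩
      rw [Subgroup.mem_subgroupOf] at h ⊢
      rwa [he, hψT] at h
  let φ := QuotientGroup.congr _ _ e heK
  have hφ : ∀ n : N, φ (QuotientGroup.mk n) = QuotientGroup.mk (e n) := fun n => rfl
  have hψψ : ∀ g, ψ (ψ g) = (θ x * x)⁻¹ * g * (θ x * x) := fun g => by
    simp [hψ, hθ2, mul_assoc]
  have hc : θ x * x ∈ Bp ⊓ N := by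
    have hpp : ∀ b, (θ x * x)⁻¹ * b * (θ x * x) ∈ Bp ↔ b ∈ Bp := fun b => by
      rw [← hψψ, hψm, hψp]
    have hmm : ∀ b, (θ x * x)⁻¹ * b * (θ x * x) ∈ Bm ↔ b ∈ Bm := fun b => by
      rw [← hψψ, hψp, hψm]
    exact hnorm _ (fun b => (hpp b).2) (fun b => (hmm b).2)
  have hφφ : ∀ w, φ (φ w) = w := fun w => by
    obtain ⟨n, rfl⟩ := QuotientGroup.mk_surjective w
    rw [hφ, hφ]
    exact (hconj _ hc n _ (by rw [he, he, hψψ])).symm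
  have hsub : ∀ i, φ (cs.simple i) ∈ Set.range cs.simple := fun i => by
    obtain ⟨s, hs⟩ := QuotientGroup.mk_surjective (cs.simple i)
    have hsq : (QuotientGroup.mk s : N ⧸ (Bp ⊓ N).subgroupOf N) * QuotientGroup.mk s = 1 := by
      rw [hs, cs.simple_mul_simple_self]
    rw [← hs, hφ]
    refine hm.mem_range_simple ?_ ?_ fun b hb => ?_
    · rw [← hφ, Ne, map_eq_one_iff φ φ.injective, hs]
      intro h1
      have := cs.length_simple i
      rw [h1, cs.length_one] at this
      lia
    · rw [← hφ, ← map_mul, hsq, map_one]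
    · obtain ⟨a, rfl⟩ := ψ.surjective b
      rw [hψp] at hb
      have hp := hTits Bp (Or.inl rfl)
      rw [he, ← map_mul, ← map_mul, hψp]
      refine (hp.mul_mul_mem s s ⟨i, hs.symm⟩ a hb).imp (fun h => ?_) (fun h => ?_)
      · rwa [hsq, hp.mem_one_iff] at h
      · obtain ⟨b1, hb1, b2, hb2, h⟩ := (mem_doubleCoset'_iff hp.coe_mem).1 h
        rw [mem_doubleCoset'_iff hm.coe_mem, h]
        exact ⟨ψ b1, (hψp _).2 hb1, ψ b2, (hψp _).2 hb2, by simp [he]⟩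
  refine ⟨φ, fun n m h => ?_, ?_, hφφ, fun x' hp' hm' n m h => ?_⟩
  · rw [hφ]
    congr 1
    exact Subtype.ext (by rw [he, hψ, h])
  · apply Set.Subset.antisymm
    · rintro _ ⟨_, ⟨i, rfl⟩, rfl⟩
      exact hsub i
    · rintro _ ⟨i, rfl⟩
      exact ⟨_, hsub i, hφφ _⟩
  · have hd : ∀ b, ψ b = (x'⁻¹ * x)⁻¹ * (x'⁻¹ * θ b * x') * (x'⁻¹ * x) := fun b => by
      rw [hψ]
      group
    have hsurj : ∀ b, ∃ a, x'⁻¹ * θ a * x' = b := fun b =>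
      ⟨θ (x' * b * x'⁻¹), by rw [hθ2]; group⟩
    have hpp : ∀ b, (x'⁻¹ * x)⁻¹ * b * (x'⁻¹ * x) ∈ Bp ↔ b ∈ Bp := fun b => by
      obtain ⟨a, rfl⟩ := hsurj b
      rw [← hd, hψm, hflip x' _ _ hm']
    have hmm : ∀ b, (x'⁻¹ * x)⁻¹ * b * (x'⁻¹ * x) ∈ Bm ↔ b ∈ Bm := fun b => by
      obtain ⟨a, rfl⟩ := hsurj b
      rw [← hd, hψp, hflip x' _ _ hp']
    have hd' : x'⁻¹ * x ∈ Bp ⊓ N := hnorm _ (fun b => (hpp b).2) (fun b => (hmm b).2)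
    rw [hφ]
    exact (hconj _ hd' m _ (by rw [he, hd, h])).symm
end

section
/- Let c ∈ C_ε be a chamber with w := δ^θ(c) and let s ∈ S with ℓ(swθ(s)) = ℓ(w) − 2. Then every chamber d ∈ P_s(c) with d ≠ c satisfies δ^θ(d) = swθ(s); moreover, for every d ∈ P_s(c) with d ≠ c and every e ∈ P_{θ(s)}(θ(c)), one has ℓ(δ*(d,e)) < ℓ(δ*(c,e)). -/
universe u v

/-- A twin building of type `(W,S)` (where `S` is the set of simple reflections of the
Coxeter system `cs`), with positive half `Cp` and negative half `Cm`, distance functions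
`δp`, `δm`, codistance `δst : Cp × Cm → W`, `δts : Cm × Cp → W`, together with a
quasi-flip: maps `θp : Cp → Cm`, `θm : Cm → Cp` inverse to each other and an automorphism
`π` of `W` with `π(S) = S`, `π ∘ π = id`, compatible with the distances and the
codistance. -/
structure QuasiFlipTwinBuilding {B : Type*} {W : Type*} [Group W]
    (M : CoxeterMatrix B) (cs : CoxeterSystem M W)
    (Cp : Type u) (Cm : Type v) where
  δp : Cp → Cp → W
  δm : Cm → Cm → W
  δst : Cp → Cm → W
  δts : Cm → Cp → W
  θp : Cp → Cm
  θm : Cm → Cp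
  π : W ≃* W
  nonempty_p : Nonempty Cp
  nonempty_m : Nonempty Cm
  /-- (Bu1) for the positive half -/
  p_eq_one_iff : ∀ x y : Cp, δp x y = 1 ↔ x = y
  /-- (Bu1) for the negative half -/
  m_eq_one_iff : ∀ x y : Cm, δm x y = 1 ↔ x = y
  /-- (Bu2) for the positive half -/
  p_two : ∀ (x y z : Cp) (s : W), s ∈ Set.range cs.simple → δp y z = s →
    δp x z = δp x y ∨ δp x z = δp x y * s
  p_two' : ∀ (x y z : Cp) (s : W), s ∈ Set.range cs.simple → δp y z = s →
    cs.length (δp x y * s) = cs.length (δp x y) + 1 → δp x z = δp x y * s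
  /-- (Bu2) for the negative half -/
  m_two : ∀ (x y z : Cm) (s : W), s ∈ Set.range cs.simple → δm y z = s →
    δm x z = δm x y ∨ δm x z = δm x y * s
  m_two' : ∀ (x y z : Cm) (s : W), s ∈ Set.range cs.simple → δm y z = s →
    cs.length (δm x y * s) = cs.length (δm x y) + 1 → δm x z = δm x y * s
  /-- (Bu3) for the positive half -/
  p_three : ∀ (x y : Cp) (s : W), s ∈ Set.range cs.simple →
    ∃ z : Cp, δp y z = s ∧ δp x z = δp x y * s
  /-- (Bu3) for the negative half -/
  m_three : ∀ (x y : Cm) (s : W), s ∈ Set.range cs.simple →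
    ∃ z : Cm, δm y z = s ∧ δm x z = δm x y * s
  /-- (Tw1) -/
  tw1 : ∀ (x : Cp) (y : Cm), δts y x = (δst x y)⁻¹
  /-- (Tw2), positive-to-negative -/
  tw2p : ∀ (x : Cp) (y z : Cm) (s : W), s ∈ Set.range cs.simple → δm y z = s →
    cs.length (δst x y * s) + 1 = cs.length (δst x y) → δst x z = δst x y * s
  /-- (Tw2), negative-to-positive -/
  tw2m : ∀ (x : Cm) (y z : Cp) (s : W), s ∈ Set.range cs.simple → δp y z = s →
    cs.length (δts x y * s) + 1 = cs.length (δts x y) → δts x z = δts x y * s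
  /-- (Tw3), positive-to-negative -/
  tw3p : ∀ (x : Cp) (y : Cm) (s : W), s ∈ Set.range cs.simple →
    ∃ z : Cm, δm y z = s ∧ δst x z = δst x y * s
  /-- (Tw3), negative-to-positive -/
  tw3m : ∀ (x : Cm) (y : Cp) (s : W), s ∈ Set.range cs.simple →
    ∃ z : Cp, δp y z = s ∧ δts x z = δts x y * s
  /-- `θ ∘ θ = id` -/
  θmθp : ∀ c : Cp, θm (θp c) = c
  θpθm : ∀ c : Cm, θp (θm c) = c
  /-- `π(S) = S` -/
  πS : ⇑π '' Set.range cs.simple = Set.range cs.simple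
  /-- `π ∘ π = id` -/
  ππ : ∀ w : W, π (π w) = w
  /-- `θ` interchanges the distances via `π` -/
  flip_p : ∀ x y : Cp, δm (θp x) (θp y) = π (δp x y)
  flip_m : ∀ x y : Cm, δp (θm x) (θm y) = π (δm x y)
  /-- `θ` preserves the codistance via `π` -/
  flip_st : ∀ (x : Cp) (z : Cm), δts (θp x) (θm z) = π (δst x z)
  flip_ts : ∀ (x : Cm) (z : Cp), δst (θm x) (θp z) = π (δts x z)

namespace QuasiFlipTwinBuilding

variable {B : Type*} {W : Type*} [Group W] {M : CoxeterMatrix B} {cs : CoxeterSystem M W}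
  {Cp : Type u} {Cm : Type v}

/-- The same twin building with a quasi-flip, with the roles of the two halves
interchanged. -/
def swap (T : QuasiFlipTwinBuilding M cs Cp Cm) : QuasiFlipTwinBuilding M cs Cm Cp where
  δp := T.δm
  δm := T.δp
  δst := T.δts
  δts := T.δst
  θp := T.θm
  θm := T.θp
  π := T.π
  nonempty_p := T.nonempty_m
  nonempty_m := T.nonempty_p
  p_eq_one_iff := T.m_eq_one_iff
  m_eq_one_iff := T.p_eq_one_iff
  p_two := T.m_two
  p_two' := T.m_two'
  m_two := T.p_two
  m_two' := T.p_two'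
  p_three := T.m_three
  m_three := T.p_three
  tw1 := fun x y => by rw [T.tw1 y x, inv_inv]
  tw2p := T.tw2m
  tw2m := T.tw2p
  tw3p := T.tw3m
  tw3m := T.tw3p
  θmθp := T.θpθm
  θpθm := T.θmθp
  πS := T.πS
  ππ := T.ππ
  flip_p := T.flip_m
  flip_m := T.flip_p
  flip_st := T.flip_ts
  flip_ts := T.flip_st

variable (T : QuasiFlipTwinBuilding M cs Cp Cm)

/-- The `θ`-codistance `δ^θ(c) = δ*(c, θ(c))` of a chamber of the positive half. -/
def δθ (c : Cp) : W := T.δst c (T.θp c)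

/-- The numerical `θ`-codistance `ℓ^θ(c) = ℓ(δ^θ(c))`. -/
noncomputable def ℓθ (c : Cp) : ℕ := cs.length (T.δθ c)

/-- The `s`-panel of a chamber `c`. -/
def panel (s : W) (c : Cp) : Set Cp := {d | T.δp c d = 1 ∨ T.δp c d = s}

/-- The `J`-residue of a chamber `c`. -/
def residue (J : Set W) (c : Cp) : Set Cp := {d | T.δp c d ∈ Subgroup.closure J}

/-- Opposition of chambers: `δ*(c,d) = 1`. -/
def Opp (c : Cp) (d : Cm) : Prop := T.δst c d = 1

/-- `R` is a Phan residue of type `J`: `R` is a `J`-residue, every chamber of `R` is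
opposite some chamber of `θ(R)`, and every chamber of `θ(R)` is opposite some chamber
of `R`. -/
def IsPhan (J : Set W) (R : Set Cp) : Prop :=
  (∃ c : Cp, R = T.residue J c) ∧
  (∀ r ∈ R, ∃ r' ∈ R, T.Opp r (T.θp r')) ∧
  (∀ r' ∈ R, ∃ r ∈ R, T.Opp r (T.θp r'))

/-- `R` is a minimal Phan residue of type `J`: it is a Phan residue containing no Phan
residue as a proper subset. -/
def IsMinPhan (J : Set W) (R : Set Cp) : Prop :=
  T.IsPhan J R ∧ ∀ (J' : Set W) (R' : Set Cp), J' ⊆ Set.range cs.simple →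
    T.IsPhan J' R' → R' ⊆ R → R' = R

/-- Two chambers are `J`-adjacent: they are `j`-adjacent for some `j ∈ J`. -/
def adjJ (J : Set W) (c d : Cp) : Prop := ∃ j ∈ J, T.δp c d = 1 ∨ T.δp c d = j

/-- There is a `J`-gallery from `c` to `d` all of whose chambers lie in `X`. -/
def GalleryIn (X : Set Cp) (J : Set W) (c d : Cp) : Prop :=
  ∃ γ : List Cp, γ.head? = some c ∧ γ.getLast? = some d ∧
    γ.Chain' (T.adjJ J) ∧ ∀ x ∈ γ, x ∈ X

/-- The flip-flop system of a set `R` of chambers: the chambers of `R` whose numerical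
`θ`-codistance is minimal among chambers of `R`. -/
def flipflop (R : Set Cp) : Set Cp := {c ∈ R | ∀ d ∈ R, T.ℓθ c ≤ T.ℓθ d}

/-- The flip-flop system `R^θ` is connected: any two of its chambers are joined by a
gallery all of whose chambers lie in `R^θ`. -/
def ConnectedFF (R : Set Cp) : Prop :=
  ∀ c ∈ T.flipflop R, ∀ d ∈ T.flipflop R,
    T.GalleryIn (T.flipflop R) (Set.range cs.simple) c d

/-- `R` admits direct descent into `R^θ`: from every chamber of `R` there is a gallery
within `R` ending in `R^θ` along which the numerical `θ`-codistance strictly decreases. -/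
def DirectDescent (R : Set Cp) : Prop :=
  ∀ c ∈ R, ∃ γ : List Cp, γ.head? = some c ∧
    (∃ e, γ.getLast? = some e ∧ e ∈ T.flipflop R) ∧
    γ.Chain' (T.adjJ (Set.range cs.simple)) ∧
    γ.Chain' (fun a b => T.ℓθ b < T.ℓθ a) ∧
    ∀ x ∈ γ, x ∈ R

/-- The quasi-flip is strong on this half: for every chamber `c` and every `s ∈ S` there
are chambers `d, x` in the `s`-panel of `c` with `ℓ(δ*(x, θ(d))) > ℓ(δ*(d, θ(d)))`,
i.e. the projection of `θ(d)` onto the panel is not `d`. -/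
def IsStrongHalf : Prop :=
  ∀ (c : Cp) (s : W), s ∈ Set.range cs.simple →
    ∃ d ∈ T.panel s c, ∃ x ∈ T.panel s c,
      cs.length (T.δst d (T.θp d)) < cs.length (T.δst x (T.θp d))

end QuasiFlipTwinBuilding

namespace QuasiFlipTwinBuilding

variable {B : Type*} {W : Type*} [Group W] {M : CoxeterMatrix B} {cs : CoxeterSystem M W}
  {Cp : Type u} {Cm : Type v} (T : QuasiFlipTwinBuilding M cs Cp Cm)

/-- The left-handed form of (Tw2): moving the first argument of the codistance along an
`s`-panel in a length-decreasing direction multiplies the codistance by `s` on the left. -/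
theorem δst_eq_simple_mul {x z : Cp} {y : Cm} {s : W} (hs : s ∈ Set.range cs.simple)
    (hxz : T.δp x z = s)
    (hlen : cs.length (s * T.δst x y) + 1 = cs.length (T.δst x y)) :
    T.δst z y = s * T.δst x y := by
  have hinv : s⁻¹ = s := by
    obtain ⟨i, rfl⟩ := hs
    exact cs.inv_simple i
  have key : (T.δst x y)⁻¹ * s = (s * T.δst x y)⁻¹ := by rw [mul_inv_rev, hinv]
  have h := T.tw2m y x z s hs hxz
    (by rw [T.tw1, key, cs.length_inv, cs.length_inv, hlen])
  rwa [T.tw1, T.tw1, key, inv_inj] at h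

end QuasiFlipTwinBuilding

/-- If multiplying by a simple reflection on each side shortens `w` by two, then each of the
intermediate multiplications shortens by one. -/
theorem CoxeterSystem.length_succ_of_length_simple_mul_mul_simple_add_two
    {B : Type*} {W : Type*} [Group W] {M : CoxeterMatrix B} (cs : CoxeterSystem M W)
    {w s t : W} (hs : s ∈ Set.range cs.simple) (ht : t ∈ Set.range cs.simple)
    (h : cs.length (s * w * t) + 2 = cs.length w) :
    cs.length (s * w) + 1 = cs.length w ∧ cs.length (w * t) + 1 = cs.length w ∧
      cs.length (s * w * t) + 1 = cs.length (s * w) := by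
  obtain ⟨i, rfl⟩ := hs
  obtain ⟨j, rfl⟩ := ht
  have h₁ := cs.length_simple_mul w i
  have h₂ := cs.length_mul_simple w j
  have h₃ := cs.length_mul_simple (cs.simple i * w) j
  have h₄ := cs.length_simple_mul (w * cs.simple j) i
  rw [← mul_assoc] at h₄
  omega

open QuasiFlipTwinBuilding in
/-- Let `c` be a chamber with `θ`-codistance `w := δ^θ(c)` and let `s ∈ S` with
`ℓ(swθ(s)) = ℓ(w) − 2`.  Then every chamber `d ≠ c` of the `s`-panel of `c` has
`θ`-codistance `swθ(s)`; moreover the projections satisfy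
`proj_{P_s(c)}(θ(P_s(c))) = {c}` and `proj_{θ(P_s(c))}(P_s(c)) = {θ(c)}`, i.e.
`ℓ(δ*(d,e)) < ℓ(δ*(c,e))` for all `d ∈ P_s(c) ∖ {c}` and `e ∈ P_{θ(s)}(θ(c))`. -/
theorem steep_descent_of_length_sub_two
    {B : Type*} {W : Type*} [Group W] {M : CoxeterMatrix B} {cs : CoxeterSystem M W}
    {Cp : Type u} {Cm : Type v} (T : QuasiFlipTwinBuilding M cs Cp Cm)
    (c : Cp) (s : W) (hs : s ∈ Set.range cs.simple)
    (hlen : cs.length (s * T.δθ c * T.π s) + 2 = cs.length (T.δθ c)) :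
    (∀ d ∈ T.panel s c, d ≠ c → T.δθ d = s * T.δθ c * T.π s) ∧
    (∀ d ∈ T.panel s c, d ≠ c → ∀ e ∈ T.swap.panel (T.π s) (T.θp c),
      cs.length (T.δst d e) < cs.length (T.δst c e)) := by
  have ht : T.π s ∈ Set.range cs.simple := T.πS ▸ Set.mem_image_of_mem _ hs
  obtain ⟨hsw, hwt, hswt⟩ :=
    cs.length_succ_of_length_simple_mul_mul_simple_add_two hs ht hlen
  have hadj : ∀ d ∈ T.panel s c, d ≠ c → T.δp c d = s := fun d hd hdc =>
    hd.resolve_left fun h => hdc ((T.p_eq_one_iff c d).1 h).symm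
  have hd_left : ∀ d, T.δp c d = s → T.δst d (T.θp c) = s * T.δθ c := fun _ hd =>
    T.δst_eq_simple_mul hs hd hsw
  have hd_both : ∀ d e, T.δp c d = s → T.δm (T.θp c) e = T.π s →
      T.δst d e = s * T.δθ c * T.π s := fun d e hd he => by
    rw [T.tw2p d (T.θp c) e (T.π s) ht he (by rw [hd_left d hd, hswt]), hd_left d hd]
  refine ⟨fun d hd hdc => ?_, fun d hd hdc e he => ?_⟩
  · exact hd_both d _ (hadj d hd hdc) (by rw [T.flip_p, hadj d hd hdc])
  · have hcd := hadj d hd hdc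
    rcases he with he | he
    · obtain rfl := (T.m_eq_one_iff (T.θp c) e).1 he
      rw [hd_left d hcd]
      change _ < cs.length (T.δθ c)
      omega
    · have hce : T.δst c e = T.δθ c * T.π s := T.tw2p c (T.θp c) e (T.π s) ht he hwt
      rw [hd_both d e hcd he, hce]
      omega
end

section
/- Let r ∈ W be a θ-twisted involution and let w ∈ W satisfy ℓ(w⁻¹rθ(w)) = ℓ(r) − 2ℓ(w). If c, d ∈ C_ε are chambers with δ^θ(c) = r and δ_ε(c,d) = w, then δ^θ(d) = w⁻¹rθ(w). -/
universe u v

namespace QuasiFlipTwinBuilding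

section

variable {B : Type*} {W : Type*} [Group W] {M : CoxeterMatrix B} {cs : CoxeterSystem M W}
  {Cp : Type u} {Cm : Type v} (T : QuasiFlipTwinBuilding M cs Cp Cm)

theorem δm_symm_of_simple {y z : Cm} {s : W} (hs : s ∈ Set.range cs.simple)
    (h : T.δm y z = s) : T.δm z y = s := by
  have h1 : T.δm z z = 1 := (T.m_eq_one_iff z z).2 rfl
  obtain ⟨i, rfl⟩ := hs
  rcases T.m_two z y z _ ⟨i, rfl⟩ h with h2 | h2
  · rw [h1] at h2
    obtain rfl := (T.m_eq_one_iff z y).1 h2.symm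
    rw [← h, h1]
  · rw [h1] at h2
    rw [eq_inv_of_mul_eq_one_left h2.symm, cs.inv_simple]

/-- Moving along a distance `w` that shortens the codistance maximally multiplies the
codistance by `w`. -/
theorem δst_eq_mul_of_length_add (x : Cp) (y z : Cm)
    (hlen : cs.length (T.δst x y * T.δm y z) + cs.length (T.δm y z) =
      cs.length (T.δst x y)) :
    T.δst x z = T.δst x y * T.δm y z := by
  generalize hn : cs.length (T.δm y z) = n at hlen
  induction n generalizing z with
  | zero =>
    have h1 := cs.length_eq_zero_iff.1 hn
    obtain rfl := (T.m_eq_one_iff y z).1 h1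
    rw [h1, mul_one]
  | succ n ih =>
    have hne : T.δm y z ≠ 1 := by
      intro h
      rw [h, cs.length_one] at hn
      omega
    obtain ⟨i, hi⟩ := cs.exists_rightDescent_of_ne_one hne
    have hdesc := cs.isRightDescent_iff.1 hi
    obtain ⟨z', hz', hyz'⟩ := T.m_three y z (cs.simple i) ⟨i, rfl⟩
    have hz'z := T.δm_symm_of_simple ⟨i, rfl⟩ hz'
    rw [← hyz'] at hdesc
    have hw : T.δm y z = T.δm y z' * cs.simple i := by
      rw [hyz', cs.simple_mul_simple_cancel_right]
    rw [hw, ← mul_assoc] at hlen ⊢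
    have h1 := cs.length_le_length_mul_add_right (T.δst x y) (T.δm y z')
    have h2 := cs.length_le_length_mul_add_right (T.δst x y * T.δm y z') (cs.simple i)
    rw [cs.length_simple] at h2
    have h4 := ih z' (by omega) (by omega)
    rw [T.tw2p x z' z _ ⟨i, rfl⟩ hz'z (by rw [h4]; omega), h4]

theorem length_π_le (w : W) : cs.length (T.π w) ≤ cs.length w := by
  obtain ⟨l, hl, rfl⟩ := cs.exists_isReduced w
  have key : ∀ l : List B, cs.length (T.π (cs.wordProd l)) ≤ l.length := by
    intro l
    induction l with
    | nil => simp
    | cons i l ih =>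
      obtain ⟨j, hj⟩ : T.π (cs.simple i) ∈ Set.range cs.simple :=
        T.πS ▸ Set.mem_image_of_mem _ ⟨i, rfl⟩
      rw [cs.wordProd_cons, map_mul, ← hj, List.length_cons]
      have := cs.length_mul_le (cs.simple j) (T.π (cs.wordProd l))
      rw [cs.length_simple] at this
      omega
  exact (key l).trans_eq hl.symm

theorem length_π (w : W) : cs.length (T.π w) = cs.length w := by
  refine le_antisymm (T.length_π_le w) ?_
  simpa only [T.ππ] using T.length_π_le (T.π w)

end

end QuasiFlipTwinBuilding

open QuasiFlipTwinBuilding in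
/-- Let `r ∈ W` be a `θ`-twisted involution and let `w ∈ W` satisfy
`ℓ(w⁻¹rθ(w)) = ℓ(r) − 2ℓ(w)`.  If `c, d` are chambers with `δ^θ(c) = r` and
`δ(c,d) = w`, then `δ^θ(d) = w⁻¹rθ(w)`. -/
theorem thetaCodistance_of_distance_twisted
    {B : Type*} {W : Type*} [Group W] {M : CoxeterMatrix B} {cs : CoxeterSystem M W}
    {Cp : Type u} {Cm : Type v} (T : QuasiFlipTwinBuilding M cs Cp Cm)
    (r w : W) (hr : T.π r = r⁻¹)
    (hlen : cs.length (w⁻¹ * r * T.π w) + 2 * cs.length w = cs.length r)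
    (c d : Cp) (hc : T.δθ c = r) (hcd : T.δp c d = w) :
    T.δθ d = w⁻¹ * r * T.π w := by
  subst hcd
  subst hc
  have hπ := T.length_π (T.δp c d)
  have h2 := cs.length_mul_le ((T.δp c d)⁻¹ * T.δθ c * T.π (T.δp c d)) (T.π (T.δp c d))⁻¹
  have h3 := cs.length_mul_le (T.δp c d) ((T.δp c d)⁻¹ * T.δθ c)
  rw [mul_inv_cancel_right, cs.length_inv] at h2
  rw [mul_inv_cancel_left] at h3
  have hinv : (T.δθ c)⁻¹ * T.δp c d = ((T.δp c d)⁻¹ * T.δθ c)⁻¹ := by group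
  have h5 : T.δts (T.θp c) d = T.δts (T.θp c) c * T.δp c d := by
    refine T.swap.δst_eq_mul_of_length_add (T.θp c) c d ?_
    change cs.length (T.δts (T.θp c) c * T.δp c d) + cs.length (T.δp c d) =
      cs.length (T.δts (T.θp c) c)
    rw [T.tw1]
    change cs.length ((T.δθ c)⁻¹ * T.δp c d) + cs.length (T.δp c d) = cs.length (T.δθ c)⁻¹
    rw [hinv, cs.length_inv, cs.length_inv]
    omega
  have h6 : T.δst d (T.θp c) = (T.δp c d)⁻¹ * T.δθ c := by
    rw [T.tw1, T.tw1] at h5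
    rw [← inv_inj, h5]
    exact hinv
  have h7 := T.δst_eq_mul_of_length_add d (T.θp c) (T.θp d)
    (by rw [T.flip_p, h6]; omega)
  rw [T.flip_p, h6] at h7
  exact h7
end

section
/- Let r ∈ W be a θ-twisted involution and let w ∈ W satisfy ℓ(w⁻¹rθ(w)) = ℓ(r) − 2ℓ(w). If d ∈ C_ε is a chamber with δ^θ(d) = w⁻¹rθ(w), then there exists a unique chamber c ∈ C_ε with δ_ε(c,d) = w and δ^θ(c) = r. -/
universe u v

/-- Induction on elements of a Coxeter group along reduced words, growing on the right. -/
theorem CoxeterSystem.induction_reduced_right {B W : Type*} [Group W] {M : CoxeterMatrix B}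
    (cs : CoxeterSystem M W) {P : W → Prop} (one : P 1)
    (mul : ∀ (w s : W), s ∈ Set.range cs.simple →
      cs.length (w * s) = cs.length w + 1 → P w → P (w * s)) (w : W) : P w := by
  induction h : cs.length w generalizing w with
  | zero => rwa [cs.length_eq_zero_iff.1 h]
  | succ n ih =>
    have hw : w ≠ 1 := by
      rintro rfl
      simp at h
    obtain ⟨i, hi⟩ := cs.exists_rightDescent_of_ne_one hw
    have hi' := cs.isRightDescent_iff.1 hi
    have key := mul (w * cs.simple i) (cs.simple i) ⟨i, rfl⟩
      (by rw [cs.simple_mul_simple_cancel_right]; omega) (ih _ (by omega))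
    rwa [cs.simple_mul_simple_cancel_right] at key

theorem CoxeterSystem.mul_self_of_mem_range_simple {B W : Type*} [Group W] {M : CoxeterMatrix B}
    (cs : CoxeterSystem M W) {s : W} (hs : s ∈ Set.range cs.simple) : s * s = 1 := by
  obtain ⟨i, rfl⟩ := hs
  simp

theorem CoxeterSystem.inv_eq_of_mem_range_simple {B W : Type*} [Group W] {M : CoxeterMatrix B}
    (cs : CoxeterSystem M W) {s : W} (hs : s ∈ Set.range cs.simple) : s⁻¹ = s := by
  obtain ⟨i, rfl⟩ := hs
  simp

theorem CoxeterSystem.length_of_mem_range_simple {B W : Type*} [Group W] {M : CoxeterMatrix B}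
    (cs : CoxeterSystem M W) {s : W} (hs : s ∈ Set.range cs.simple) : cs.length s = 1 := by
  obtain ⟨i, rfl⟩ := hs
  simp

theorem CoxeterSystem.ne_one_of_mem_range_simple {B W : Type*} [Group W] {M : CoxeterMatrix B}
    (cs : CoxeterSystem M W) {s : W} (hs : s ∈ Set.range cs.simple) : s ≠ 1 := by
  rintro rfl
  simpa using cs.length_of_mem_range_simple hs

namespace QuasiFlipTwinBuilding

variable {B : Type*} {W : Type*} [Group W] {M : CoxeterMatrix B} {cs : CoxeterSystem M W}
  {Cp : Type u} {Cm : Type v} (T : QuasiFlipTwinBuilding M cs Cp Cm)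

theorem π_mem {s : W} (hs : s ∈ Set.range cs.simple) : T.π s ∈ Set.range cs.simple := by
  rw [← T.πS]
  exact Set.mem_image_of_mem _ hs

theorem δp_symm_simple {x y : Cp} {s : W} (hs : s ∈ Set.range cs.simple)
    (h : T.δp x y = s) : T.δp y x = s := by
  have hyy : T.δp y y = 1 := (T.p_eq_one_iff y y).2 rfl
  rcases T.p_two y x y s hs h with h1 | h1
  · rw [hyy] at h1
    have hyx := (T.p_eq_one_iff y x).1 h1.symm
    subst hyx
    exact hyy.symm.trans h ▸ hyy
  · rw [hyy] at h1
    rw [eq_inv_of_mul_eq_one_left h1.symm, cs.inv_eq_of_mem_range_simple hs]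

/-- Two chambers that are `s`-adjacent to a common chamber, and distinct from it, coincide
or are at distance `s`. -/
theorem eq_or_δp_eq_of_common_adj {d e e' : Cp} {s : W} (hs : s ∈ Set.range cs.simple)
    (he : T.δp d e = s) (he' : T.δp d e' = s) : e = e' ∨ T.δp e e' = s := by
  have hed := T.δp_symm_simple hs he
  rcases T.p_two e d e' s hs he' with h | h
  · exact Or.inr (h.trans hed)
  · rw [hed, cs.mul_self_of_mem_range_simple hs] at h
    exact Or.inl ((T.p_eq_one_iff _ _).1 h)

/-- Along a panel, the codistance to a fixed chamber takes at most two values. -/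
theorem δts_adj (x : Cm) {y z : Cp} {s : W} (hs : s ∈ Set.range cs.simple)
    (h : T.δp y z = s) : T.δts x z = T.δts x y ∨ T.δts x z = T.δts x y * s := by
  have hss := cs.mul_self_of_mem_range_simple hs
  obtain ⟨y', hy', hxy'⟩ := T.tw3m x y s hs
  rcases T.eq_or_δp_eq_of_common_adj hs hy' h with rfl | hyz
  · exact Or.inr hxy'
  · obtain ⟨i, rfl⟩ := hs
    rcases cs.length_mul_simple (T.δts x y) i with hl | hl
    · left
      rw [T.tw2m x y' z _ ⟨i, rfl⟩ hyz (by rw [hxy', mul_assoc, hss, mul_one]; exact hl.symm),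
        hxy', mul_assoc, hss, mul_one]
    · exact Or.inr (T.tw2m x y z _ ⟨i, rfl⟩ h hl)

/-- If the codistance can decrease by the full length of the distance travelled, it does. -/
theorem δts_of_length_add (x : Cm) {y z : Cp} {v : W} (h : T.δp y z = v)
    (hl : cs.length (T.δts x y * v) + cs.length v = cs.length (T.δts x y)) :
    T.δts x z = T.δts x y * v := by
  induction v using cs.induction_reduced_right generalizing z with
  | one => rw [(T.p_eq_one_iff _ _).1 h, mul_one]
  | mul v s hs hvs ih =>
    have hss := cs.mul_self_of_mem_range_simple hs
    obtain ⟨z', hz', hyz'⟩ := T.p_three y z s hs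
    rw [h, mul_assoc, hss, mul_one] at hyz'
    have h1 := cs.length_mul_le (T.δts x y * v * s) s
    have h2 := cs.length_mul_le (T.δts x y * v) v⁻¹
    rw [mul_assoc _ s s, hss, mul_one, cs.length_of_mem_range_simple hs] at h1
    rw [mul_inv_cancel_right, cs.length_inv] at h2
    rw [← mul_assoc] at hl ⊢
    have h3 := ih hyz' (by omega)
    rw [← h3]
    exact T.tw2m x z' z s hs (T.δp_symm_simple hs hz') (by rw [h3]; omega)

/-- A chamber is determined by its distance to `d` and its codistance to `x`, provided the
codistance to `x` decreases by the full distance on the way to `d`. -/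
theorem eq_of_δp_eq_of_δts_eq (x : Cm) {c c' d : Cp} {w : W} (hc : T.δp c d = w)
    (hc' : T.δp c' d = w) (hx : T.δts x c' = T.δts x c)
    (hl : cs.length (T.δts x c * w) + cs.length w = cs.length (T.δts x c)) : c = c' := by
  induction w using cs.induction_reduced_right generalizing d with
  | one => rw [(T.p_eq_one_iff _ _).1 hc, (T.p_eq_one_iff _ _).1 hc']
  | mul w s hs hws ih =>
    have hss := cs.mul_self_of_mem_range_simple hs
    obtain ⟨e, hde, hce⟩ := T.p_three c d s hs
    obtain ⟨e', hde', hce'⟩ := T.p_three c' d s hs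
    rw [hc, mul_assoc, hss, mul_one] at hce
    rw [hc', mul_assoc, hss, mul_one] at hce'
    have h1 := cs.length_mul_le (T.δts x c * w * s) s
    have h2 := cs.length_mul_le (T.δts x c * w) w⁻¹
    rw [mul_assoc _ s s, hss, mul_one, cs.length_of_mem_range_simple hs] at h1
    rw [mul_inv_cancel_right, cs.length_inv] at h2
    rw [← mul_assoc] at hl
    have hlw : cs.length (T.δts x c * w) + cs.length w = cs.length (T.δts x c) := by omega
    have hxe := T.δts_of_length_add x hce hlw
    have hxe' := T.δts_of_length_add x hce' (by rwa [hx])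
    have hee : e = e' := by
      refine (T.eq_or_δp_eq_of_common_adj hs hde hde').resolve_right fun hs' => ?_
      have h3 := T.tw2m x e e' s hs hs' (by rw [hxe]; omega)
      rw [hxe', hx, hxe] at h3
      exact cs.ne_one_of_mem_range_simple hs (mul_eq_left.1 h3.symm)
    subst hee
    exact ih hce hce' hlw

theorem δts_θp_eq (c d : Cp) : T.δts (T.θp d) c = T.π (T.δst d (T.θp c)) := by
  rw [← T.flip_st, T.θmθp]

/-- Raising the `θ`-codistance by two within a panel. -/
theorem exists_adj_δθ_eq (d : Cp) {s : W} (hs : s ∈ Set.range cs.simple)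
    (hne : s * T.δθ d * T.π s ≠ T.δθ d) :
    ∃ e, T.δp e d = s ∧ T.δθ e = s * T.δθ d * T.π s := by
  have hsi := cs.inv_eq_of_mem_range_simple hs
  have hπi := cs.inv_eq_of_mem_range_simple (T.π_mem hs)
  have hππ := cs.mul_self_of_mem_range_simple (T.π_mem hs)
  obtain ⟨e, hde, he⟩ := T.tw3m (T.θp d) d s hs
  refine ⟨e, T.δp_symm_simple hs hde, ?_⟩
  have hst : T.δst e (T.θp d) = s * T.δθ d := by
    rw [← inv_inj, ← T.tw1, he, T.tw1, mul_inv_rev, hsi, δθ]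
  have hts : T.δts (T.θp e) d = T.π s * (T.δθ d)⁻¹ := by
    rw [T.δts_θp_eq, hst, map_mul, δθ, ← T.δts_θp_eq, T.tw1]
  have h1 : T.δθ e = s * T.δθ d ∨ T.δθ e = s * T.δθ d * T.π s := by
    have := T.swap.δts_adj e (T.π_mem hs) ((T.flip_p d e).trans (by rw [hde]))
    change T.δst e (T.θp e) = T.δst e (T.θp d) ∨
      T.δst e (T.θp e) = T.δst e (T.θp d) * T.π s at this
    rwa [hst] at this
  have h2 : T.δθ e = T.δθ d * T.π s ∨ T.δθ e = s * T.δθ d * T.π s := by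
    have := T.δts_adj (T.θp e) hs hde
    rw [hts, T.tw1, inv_eq_iff_eq_inv, inv_eq_iff_eq_inv] at this
    simpa only [mul_inv_rev, inv_inv, hsi, hπi, ← mul_assoc, δθ] using this
  rcases h1 with h1 | h1
  · rcases h2 with h2 | h2
    · refine absurd ?_ hne
      rw [← h1, h2, mul_assoc, hππ, mul_one]
    · exact h2
  · exact h1

theorem exists_chamber_twisted (r w : W)
    (hlen : cs.length (w⁻¹ * r * T.π w) + 2 * cs.length w = cs.length r)
    (d : Cp) (hd : T.δθ d = w⁻¹ * r * T.π w) :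
    ∃ c : Cp, T.δp c d = w ∧ T.δθ c = r := by
  induction w using cs.induction_reduced_right generalizing d with
  | one => exact ⟨d, (T.p_eq_one_iff _ _).2 rfl, by simpa using hd⟩
  | mul w s hs hws ih =>
    have hsi := cs.inv_eq_of_mem_range_simple hs
    have hss := cs.mul_self_of_mem_range_simple hs
    have hππ := cs.mul_self_of_mem_range_simple (T.π_mem hs)
    set q := w⁻¹ * r * T.π w with hq
    have hsq : (w * s)⁻¹ * r * T.π (w * s) = s * q * T.π s := by
      simp only [hq, mul_inv_rev, map_mul, hsi, mul_assoc]
    have hqs : s * (s * q * T.π s) * T.π s = q := by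
      rw [mul_assoc s q, ← mul_assoc s s, hss, one_mul, mul_assoc, hππ, mul_one]
    rw [hsq] at hlen hd
    have h1 := cs.length_mul_le (s * (s * q * T.π s)) (T.π s)
    have h2 := cs.length_mul_le s (s * q * T.π s)
    have h3 := cs.length_mul_le (w * q) (T.π w)⁻¹
    have h4 := cs.length_mul_le w q
    have hr : w * q * (T.π w)⁻¹ = r := by simp [hq, mul_assoc]
    rw [hqs, T.length_π, cs.length_of_mem_range_simple hs] at h1
    rw [cs.length_of_mem_range_simple hs] at h2
    rw [hr, cs.length_inv, T.length_π] at h3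
    obtain ⟨e, hed, he⟩ := T.exists_adj_δθ_eq d hs (by
      rw [hd, hqs]
      intro h
      rw [← h] at hlen
      omega)
    rw [hd, hqs] at he
    obtain ⟨c, hce, hc⟩ := ih (by omega) e he
    refine ⟨c, ?_, hc⟩
    rw [T.p_two' c e d s hs hed (by rwa [hce]), hce]

theorem eq_of_chamber_twisted (r w : W)
    (hlen : cs.length (w⁻¹ * r * T.π w) + 2 * cs.length w = cs.length r)
    {c c' d : Cp} (hcd : T.δp c d = w) (hc : T.δθ c = r)
    (hcd' : T.δp c' d = w) (hc' : T.δθ c' = r) : c = c' := by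
  have h1 := cs.length_mul_le (r * T.π w) (T.π w)⁻¹
  have h2 := cs.length_mul_le w (w⁻¹ * r * T.π w)
  rw [mul_inv_cancel_right, cs.length_inv, T.length_π] at h1
  rw [mul_assoc w⁻¹, mul_inv_cancel_left, ← mul_assoc] at h2
  have key : ∀ a : Cp, T.δp a d = w → T.δθ a = r → T.δts (T.θp d) a = (r * T.π w)⁻¹ := by
    intro a had ha
    have hst : T.δst a (T.θp d) = T.δst a (T.θp a) * T.π w := by
      refine T.swap.δts_of_length_add a ((T.flip_p a d).trans (by rw [had])) ?_
      change cs.length (T.δθ a * T.π w) + cs.length (T.π w) = cs.length (T.δθ a)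
      rw [ha, T.length_π]
      omega
    rw [T.tw1, hst, ← ha, δθ]
  have hk := key c hcd hc
  refine T.eq_of_δp_eq_of_δts_eq (T.θp d) hcd hcd' ((key c' hcd' hc').trans hk.symm) ?_
  have hinv : (r * T.π w)⁻¹ * w = (w⁻¹ * r * T.π w)⁻¹ := by simp [mul_assoc]
  rw [hk, hinv, cs.length_inv, cs.length_inv]
  omega

end QuasiFlipTwinBuilding

open QuasiFlipTwinBuilding in
/-- Let `r ∈ W` be a `θ`-twisted involution and let `w ∈ W` satisfy
`ℓ(w⁻¹rθ(w)) = ℓ(r) − 2ℓ(w)`.  If `d` is a chamber with `δ^θ(d) = w⁻¹rθ(w)`, then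
there exists a unique chamber `c` with `δ(c,d) = w` and `δ^θ(c) = r`. -/
theorem exists_unique_chamber_twisted
    {B : Type*} {W : Type*} [Group W] {M : CoxeterMatrix B} {cs : CoxeterSystem M W}
    {Cp : Type u} {Cm : Type v} (T : QuasiFlipTwinBuilding M cs Cp Cm)
    (r w : W) (hr : T.π r = r⁻¹)
    (hlen : cs.length (w⁻¹ * r * T.π w) + 2 * cs.length w = cs.length r)
    (d : Cp) (hd : T.δθ d = w⁻¹ * r * T.π w) :
    ∃! c : Cp, T.δp c d = w ∧ T.δθ c = r := by
  obtain ⟨c, hcd, hc⟩ := T.exists_chamber_twisted r w hlen d hd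
  exact ⟨c, ⟨hcd, hc⟩, fun c' h => T.eq_of_chamber_twisted r w hlen h.1 h.2 hcd hc⟩
end
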